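/- Let f ∈ Lip(α,p) with p > 1 and 0 < α < 1, let (p_k) be positive, P_n = p_0 + ... + p_n, and suppose (p_k) ∈ AMIMS, i.e., the Cesàro means of (p_k) form an almost monotone increasing sequence. Then ‖R_n(f) − f‖_{L^p} = O(n^{−α}). -/

import Mathlib

open MeasureTheory Finset Real

/-- The Dirichlet kernel `D_n(u) = 1/2 + ∑_{k=1}^n cos(k u)`. -/
noncomputable def dirichletKernel (n : ℕ) (u : ℝ) : ℝ :=
  1 / 2 + ∑ k ∈ Finset.Icc 1 n, Real.cos (k * u)

/-- The `n`-th partial sum of the Fourier series of a `2π`-periodic function `f`,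
`S_n(f;x) = (1/π) ∫_0^{2π} f(t) D_n(x - t) dt`. -/
noncomputable def partialFourierSum (f : ℝ → ℝ) (n : ℕ) (x : ℝ) : ℝ :=
  (1 / Real.pi) * ∫ t in (0 : ℝ)..(2 * Real.pi), f t * dirichletKernel n (x - t)

/-- The normalized `L^p` norm `‖f‖_{L^p} = ((1/2π) ∫_0^{2π} |f(x)|^p dx)^{1/p}`. -/
noncomputable def lpNorm (p : ℝ) (f : ℝ → ℝ) : ℝ :=
  ((1 / (2 * Real.pi)) * ∫ x in (0 : ℝ)..(2 * Real.pi), |f x| ^ p) ^ (1 / p)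

/-- The integral modulus of continuity
`ω_p(f;δ) = sup_{0<|h|≤δ} ((1/2π) ∫_0^{2π} |f(x+h) - f(x)|^p dx)^{1/p}`. -/
noncomputable def intModulus (p : ℝ) (f : ℝ → ℝ) (δ : ℝ) : ℝ :=
  sSup {y : ℝ | ∃ h : ℝ, 0 < |h| ∧ |h| ≤ δ ∧
    y = ((1 / (2 * Real.pi)) * ∫ x in (0 : ℝ)..(2 * Real.pi), |f (x + h) - f x| ^ p) ^ (1 / p)}

/-- `f ∈ Lip(α,p)`: `f` is `2π`-periodic, belongs to `L^p[0,2π]`, and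
`ω_p(f;δ) = O(δ^α)`. -/
def LipClass (α p : ℝ) (f : ℝ → ℝ) : Prop :=
  Function.Periodic f (2 * Real.pi) ∧
  IntervalIntegrable f MeasureTheory.volume 0 (2 * Real.pi) ∧
  IntervalIntegrable (fun x => |f x| ^ p) MeasureTheory.volume 0 (2 * Real.pi) ∧
  ∃ C : ℝ, 0 < C ∧ ∀ δ : ℝ, 0 < δ → intModulus p f δ ≤ C * δ ^ α

/-- The matrix transform `T_n(f;x) = ∑_{k=0}^n a_{n,k} S_k(f;x)`. -/
noncomputable def matrixMeans (a : ℕ → ℕ → ℝ) (f : ℝ → ℝ) (n : ℕ) (x : ℝ) : ℝ :=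
  ∑ k ∈ Finset.range (n + 1), a n k * partialFourierSum f k x

/-- `A_{n,m} = (1/(m+1)) ∑_{k=0}^m a_{n,k}`, the Cesàro mean of the `n`-th row. -/
noncomputable def rowMean (a : ℕ → ℕ → ℝ) (n m : ℕ) : ℝ :=
  (1 / ((m : ℝ) + 1)) * ∑ k ∈ Finset.range (m + 1), a n k

/-- The Riesz means `R_n(f;x) = (1/P_n) ∑_{k=0}^n p_k S_k(f;x)` with weights `w`. -/
noncomputable def rieszMeans (w : ℕ → ℝ) (f : ℝ → ℝ) (n : ℕ) (x : ℝ) : ℝ :=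
  (1 / (∑ k ∈ Finset.range (n + 1), w k)) *
    ∑ k ∈ Finset.range (n + 1), w k * partialFourierSum f k x

/-- The kernel `K_n(u) = ∑_{k=0}^n a_{n,k} sin((k+1/2)u)/(2 sin(u/2))`. -/
noncomputable def matrixKernel (a : ℕ → ℕ → ℝ) (n : ℕ) (u : ℝ) : ℝ :=
  ∑ k ∈ Finset.range (n + 1),
    a n k * (Real.sin (((k : ℝ) + 1 / 2) * u) / (2 * Real.sin (u / 2)))

open scoped ENNReal NNReal

theorem lintegral_mul_rpow_le {β : Type*} [MeasurableSpace β] {ν : Measure β} {p : ℝ} (hp : 1 < p)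
    {k G : β → ℝ≥0∞} (hk : AEMeasurable k ν) (hG : AEMeasurable G ν) :
    (∫⁻ t, k t * G t ∂ν) ^ p ≤ (∫⁻ t, k t ∂ν) ^ (p - 1) * ∫⁻ t, k t * G t ^ p ∂ν := by
  have hpq : p.HolderConjugate (p / (p - 1)) := Real.HolderConjugate.conjExponent hp
  have hp0 : 0 < p := by linarith
  have hp1 : 0 < p - 1 := by linarith
  have hH := ENNReal.lintegral_mul_le_Lp_mul_Lq ν hpq.symm (f := fun t => k t ^ ((p - 1) / p))
    (g := fun t => k t ^ (1 / p) * G t) (hk.pow_const _) ((hk.pow_const _).mul hG)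
  have hsplit : ∀ t, k t ^ ((p - 1) / p) * (k t ^ (1 / p) * G t) = k t * G t := fun t => by
    rw [← mul_assoc, ← ENNReal.rpow_add_of_nonneg _ _ (by positivity) (by positivity)]
    rw [show (p - 1) / p + 1 / p = 1 by field_simp; ring, ENNReal.rpow_one]
  have h1 : ∀ t, (k t ^ ((p - 1) / p)) ^ (p / (p - 1)) = k t := fun t => by
    rw [← ENNReal.rpow_mul, show (p - 1) / p * (p / (p - 1)) = 1 by field_simp, ENNReal.rpow_one]
  have h2 : ∀ t, (k t ^ (1 / p) * G t) ^ p = k t * G t ^ p := fun t => by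
    rw [ENNReal.mul_rpow_of_nonneg _ _ hp0.le, ← ENNReal.rpow_mul,
      show 1 / p * p = 1 by field_simp, ENNReal.rpow_one]
  simp only [Pi.mul_apply, hsplit, h1, h2] at hH
  calc (∫⁻ t, k t * G t ∂ν) ^ p ≤ _ := ENNReal.rpow_le_rpow hH hp0.le
    _ = _ := by
      rw [ENNReal.mul_rpow_of_nonneg _ _ hp0.le, ← ENNReal.rpow_mul, ← ENNReal.rpow_mul,
        show 1 / p * p = 1 by field_simp, ENNReal.rpow_one,
        show 1 / (p / (p - 1)) * p = p - 1 by field_simp]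

theorem lintegral_lintegral_mul_rpow_le_of_forall_slice {β γ : Type*} [MeasurableSpace β]
    [MeasurableSpace γ] {μ : Measure γ} {ν : Measure β} [SFinite μ] [SFinite ν] {p : ℝ} (hp : 1 < p)
    {k : β → ℝ≥0∞} {G : γ → β → ℝ≥0∞} (hk : AEMeasurable k ν)
    (hG : AEMeasurable (Function.uncurry G) (μ.prod ν)) {B : ℝ≥0∞}
    (hB : ∀ᵐ t ∂ν, ∫⁻ x, G x t ^ p ∂μ ≤ B) :
    ∫⁻ x, (∫⁻ t, k t * G x t ∂ν) ^ p ∂μ ≤ (∫⁻ t, k t ∂ν) ^ p * B := by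
  have hGs : ∀ᵐ x ∂μ, AEMeasurable (G x) ν := by
    filter_upwards [hG.aestronglyMeasurable.prodMk_left] with x hx using hx.aemeasurable
  have hkprod : AEMeasurable (fun z : γ × β => k z.2) (μ.prod ν) := hk.comp_snd
  have hGp : AEMeasurable (fun z : γ × β => k z.2 * G z.1 z.2 ^ p) (μ.prod ν) :=
    hkprod.mul (hG.pow_const p)
  have hGt : ∀ᵐ t ∂ν, AEMeasurable (fun x => G x t) μ := by
    filter_upwards [hG.prod_swap.aestronglyMeasurable.prodMk_left] with t ht
      using ht.aemeasurable
  calc ∫⁻ x, (∫⁻ t, k t * G x t ∂ν) ^ p ∂μ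
      ≤ ∫⁻ x, (∫⁻ t, k t ∂ν) ^ (p - 1) * ∫⁻ t, k t * G x t ^ p ∂ν ∂μ :=
        lintegral_mono_ae (hGs.mono fun x hx => lintegral_mul_rpow_le hp hk hx)
    _ = (∫⁻ t, k t ∂ν) ^ (p - 1) * ∫⁻ x, ∫⁻ t, k t * G x t ^ p ∂ν ∂μ :=
        lintegral_const_mul'' _ hGp.lintegral_prod_right'
    _ = (∫⁻ t, k t ∂ν) ^ (p - 1) * ∫⁻ t, ∫⁻ x, k t * G x t ^ p ∂μ ∂ν := by
        rw [lintegral_lintegral_swap hGp]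
    _ ≤ (∫⁻ t, k t ∂ν) ^ (p - 1) * ∫⁻ t, k t * B ∂ν := by
        gcongr 1
        refine lintegral_mono_ae ?_
        filter_upwards [hB, hGt] with t ht hGt
        rw [lintegral_const_mul'' _ (hGt.pow_const p)]
        gcongr
    _ = (∫⁻ t, k t ∂ν) ^ p * B := by
        rw [lintegral_mul_const'' _ hk, ← mul_assoc]
        congr 1
        conv_lhs => rw [← ENNReal.rpow_one (∫⁻ t, k t ∂ν), ← ENNReal.rpow_mul, one_mul]
        rw [← ENNReal.rpow_add_of_nonneg _ _ (by linarith) zero_le_one]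
        ring_nf

theorem lintegral_lintegral_mul_rpow_le_of_schur {β γ : Type*} [MeasurableSpace β]
    [MeasurableSpace γ] {μ : Measure γ} {ν : Measure β} [SFinite μ] [SFinite ν] {p : ℝ} (hp : 1 < p)
    {k : γ → β → ℝ≥0∞} {g : β → ℝ≥0∞} (hk : Measurable (Function.uncurry k))
    (hg : AEMeasurable g ν) {M : ℝ≥0∞} (hM₁ : ∀ x, ∫⁻ t, k x t ∂ν ≤ M)
    (hM₂ : ∀ t, ∫⁻ x, k x t ∂μ ≤ M) :
    ∫⁻ x, (∫⁻ t, k x t * g t ∂ν) ^ p ∂μ ≤ M ^ p * ∫⁻ t, g t ^ p ∂ν := by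
  have hgp : AEMeasurable (fun z : γ × β => k z.1 z.2 * g z.2 ^ p) (μ.prod ν) :=
    hk.aemeasurable.mul (hg.comp_snd.pow_const p)
  calc ∫⁻ x, (∫⁻ t, k x t * g t ∂ν) ^ p ∂μ
      ≤ ∫⁻ x, M ^ (p - 1) * ∫⁻ t, k x t * g t ^ p ∂ν ∂μ := by
        refine lintegral_mono fun x => ?_
        refine (lintegral_mul_rpow_le hp (hk.of_uncurry_left).aemeasurable hg).trans ?_
        gcongr
        exact hM₁ x
    _ = M ^ (p - 1) * ∫⁻ x, ∫⁻ t, k x t * g t ^ p ∂ν ∂μ :=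
        lintegral_const_mul'' _ hgp.lintegral_prod_right'
    _ = M ^ (p - 1) * ∫⁻ t, ∫⁻ x, k x t * g t ^ p ∂μ ∂ν := by
        rw [lintegral_lintegral_swap hgp]
    _ ≤ M ^ (p - 1) * ∫⁻ t, M * g t ^ p ∂ν := by
        gcongr 2 with t
        rw [lintegral_mul_const _ hk.of_uncurry_right]
        gcongr
        exact hM₂ t
    _ = M ^ p * ∫⁻ t, g t ^ p ∂ν := by
        rw [lintegral_const_mul'' _ (hg.pow_const p), ← mul_assoc]
        congr 1
        conv_lhs => enter [2]; rw [← ENNReal.rpow_one M]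
        rw [← ENNReal.rpow_add_of_nonneg _ _ (by linarith) zero_le_one]
        ring_nf

/-- On the right half-plane, `|z|^p` is controlled by `(re z)^p` and the harmonic function
`re (z^p)`. -/
theorem exists_norm_rpow_le_re_rpow_sub_re_cpow {p : ℝ} (hp : 1 < p) (hp2 : p ≤ 2) :
    ∃ A B : ℝ, 0 < A ∧ 0 < B ∧ ∀ z : ℂ, 0 < z.re →
      ‖z‖ ^ p ≤ A * z.re ^ p - B * (z ^ (p : ℂ)).re := by
  have hpi := Real.pi_pos
  obtain ⟨θ₀, h₁, h₂⟩ : ∃ θ₀, π / (2 * p) < θ₀ ∧ θ₀ < π / 2 := by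
    refine exists_between (div_lt_div_of_pos_left hpi two_pos (by linarith))
  have h₁' : π / 2 < p * θ₀ := by
    rw [div_lt_iff₀ (by linarith)] at h₁
    linarith
  have hθ₀ : 0 < θ₀ := lt_trans (by positivity) h₁
  have hneg : Real.cos (p * θ₀) < 0 :=
    Real.cos_neg_of_pi_div_two_lt_of_lt h₁' (by nlinarith)
  have hpos : 0 < Real.cos θ₀ := Real.cos_pos_of_mem_Ioo ⟨by linarith, h₂⟩
  set B := 1 / (-Real.cos (p * θ₀)) with hB
  have hB0 : 0 < B := by rw [hB]; exact one_div_pos.2 (by linarith)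
  have hcp : 0 < Real.cos θ₀ ^ p := Real.rpow_pos_of_pos hpos p
  refine ⟨(1 + B) / Real.cos θ₀ ^ p, B, by positivity, hB0, fun z hz => ?_⟩
  have hz0 : 0 < ‖z‖ := hz.trans_le (Complex.re_le_norm z)
  have harg : |z.arg| < π / 2 := Complex.abs_arg_lt_pi_div_two_iff.2 (Or.inl hz)
  have hre : z.re = ‖z‖ * Real.cos |z.arg| := by
    rw [Real.cos_abs, Complex.norm_mul_cos_arg]
  have hcos : Real.cos (z.arg * p) = Real.cos (p * |z.arg|) := by
    rw [← Real.cos_abs, abs_mul, abs_of_pos (by linarith : 0 < p), mul_comm]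
  have hnp : 0 < ‖z‖ ^ p := Real.rpow_pos_of_pos hz0 p
  set θ := |z.arg| with hθ
  have hθ0 : 0 ≤ θ := abs_nonneg _
  have hc : 0 < Real.cos θ := Real.cos_pos_of_mem_Ioo ⟨by linarith, harg⟩
  rw [Complex.cpow_ofReal_re, hcos, hre, Real.mul_rpow hz0.le hc.le]
  suffices h : 1 ≤ (1 + B) / Real.cos θ₀ ^ p * Real.cos θ ^ p - B * Real.cos (p * θ) by
    calc ‖z‖ ^ p = ‖z‖ ^ p * 1 := by ring
      _ ≤ ‖z‖ ^ p * ((1 + B) / Real.cos θ₀ ^ p * Real.cos θ ^ p - B * Real.cos (p * θ)) := by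
        gcongr
      _ = _ := by ring
  rcases le_total θ θ₀ with hle | hle
  · have : Real.cos θ₀ ^ p ≤ Real.cos θ ^ p := by
      gcongr
      exact Real.cos_le_cos_of_nonneg_of_le_pi hθ0 (by linarith) hle
    have h3 : 1 + B ≤ (1 + B) / Real.cos θ₀ ^ p * Real.cos θ ^ p := by
      rw [div_mul_eq_mul_div, le_div_iff₀ hcp]
      gcongr
    nlinarith [Real.cos_le_one (p * θ)]
  · have : Real.cos (p * θ) ≤ Real.cos (p * θ₀) := by
      refine Real.cos_le_cos_of_nonneg_of_le_pi (by positivity) ?_ (by gcongr)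
      nlinarith
    have h3 : 0 ≤ (1 + B) / Real.cos θ₀ ^ p * Real.cos θ ^ p := by positivity
    have h4 : B * Real.cos (p * θ₀) = -1 := by
      rw [hB]; field_simp
      rw [div_self hneg.ne]
    nlinarith

/-- Lebesgue measure on one period `(0, 2π]`. -/
noncomputable abbrev periodMeasure : Measure ℝ := volume.restrict (Set.Ioc 0 (2 * π))

/-- The Cauchy transform of the density `g` on the unit circle. -/
noncomputable def cauchyTransform (g : ℝ → ℂ) (z : ℂ) : ℂ :=
  ∫ t, g t * (1 - z * Complex.exp (-(t * Complex.I)))⁻¹ ∂periodMeasure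

theorem norm_exp_neg_ofReal_mul_I (t : ℝ) : ‖Complex.exp (-(t * Complex.I))‖ = 1 := by
  rw [← neg_mul, ← Complex.ofReal_neg, Complex.norm_exp_ofReal_mul_I]

theorem one_sub_le_norm_one_sub_mul {z w : ℂ} (hw : ‖w‖ = 1) : 1 - ‖z‖ ≤ ‖1 - z * w‖ := by
  have := norm_sub_norm_le (1 : ℂ) (z * w)
  simpa [hw] using this

theorem one_sub_mul_ne_zero {z w : ℂ} (hz : ‖z‖ < 1) (hw : ‖w‖ = 1) : 1 - z * w ≠ 0 := by
  have := one_sub_le_norm_one_sub_mul (z := z) hw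
  exact norm_pos_iff.1 (by linarith)

theorem re_inv_one_sub_pos {w : ℂ} (hw : ‖w‖ < 1) : 0 < ((1 - w)⁻¹).re := by
  rw [Complex.inv_re]
  have h1 : w.re < 1 := (Complex.re_le_norm w).trans_lt hw
  have h2 : 1 - w ≠ 0 := fun h => by simp [← sub_eq_zero.1 h] at hw
  exact div_pos (by simpa using h1) (Complex.normSq_pos.2 h2)

theorem continuous_cauchyKernel {z : ℂ} (hz : ‖z‖ < 1) :
    Continuous fun t : ℝ => (1 - z * Complex.exp (-(t * Complex.I)))⁻¹ :=
  Continuous.inv₀ (by fun_prop) fun t => one_sub_mul_ne_zero hz (norm_exp_neg_ofReal_mul_I t)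

theorem norm_cauchyKernel_le {z : ℂ} (hz : ‖z‖ < 1) (t : ℝ) :
    ‖(1 - z * Complex.exp (-(t * Complex.I)))⁻¹‖ ≤ (1 - ‖z‖)⁻¹ := by
  rw [norm_inv]
  exact inv_anti₀ (by linarith) (one_sub_le_norm_one_sub_mul (norm_exp_neg_ofReal_mul_I t))

theorem integrable_mul_cauchyKernel {g : ℝ → ℂ} (hg : Integrable g periodMeasure) {z : ℂ}
    (hz : ‖z‖ < 1) :
    Integrable (fun t : ℝ => g t * (1 - z * Complex.exp (-(t * Complex.I)))⁻¹) periodMeasure :=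
  hg.mul_bdd (c := (1 - ‖z‖)⁻¹) (continuous_cauchyKernel hz).aestronglyMeasurable
    (Filter.Eventually.of_forall (norm_cauchyKernel_le hz))

theorem differentiableAt_cauchyTransform {g : ℝ → ℂ} (hg : Integrable g periodMeasure) {z : ℂ}
    (hz : ‖z‖ < 1) : DifferentiableAt ℂ (cauchyTransform g) z := by
  obtain ⟨ρ, hzρ, hρ⟩ := exists_between hz
  have hlt : ∀ x ∈ Metric.ball (0 : ℂ) ρ, ‖x‖ < 1 := fun x hx =>
    (mem_ball_zero_iff.1 hx).trans hρ
  have hs : Metric.ball (0 : ℂ) ρ ∈ nhds z :=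
    Metric.isOpen_ball.mem_nhds (mem_ball_zero_iff.2 hzρ)
  refine ((hasDerivAt_integral_of_dominated_loc_of_deriv_le (μ := periodMeasure) hs
    (F := fun x t => g t * (1 - x * Complex.exp (-(t * Complex.I)))⁻¹)
    (F' := fun x t => g t * (Complex.exp (-(t * Complex.I)) /
      (1 - x * Complex.exp (-(t * Complex.I))) ^ 2))
    (bound := fun t => ‖g t‖ * (1 / (1 - ρ) ^ 2)) ?_ (integrable_mul_cauchyKernel hg hz) ?_ ?_
    (hg.norm.mul_const _) ?_).2).differentiableAt
  · filter_upwards [hs] with x hx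
    exact (integrable_mul_cauchyKernel hg (hlt x hx)).aestronglyMeasurable
  · refine hg.aestronglyMeasurable.mul (Continuous.aestronglyMeasurable ?_)
    exact Continuous.div (by fun_prop) (by fun_prop) fun t =>
      pow_ne_zero 2 (one_sub_mul_ne_zero hz (norm_exp_neg_ofReal_mul_I t))
  · refine Filter.Eventually.of_forall fun t x hx => ?_
    rw [norm_mul, norm_div, norm_exp_neg_ofReal_mul_I, norm_pow]
    have h1 := one_sub_le_norm_one_sub_mul (z := x) (norm_exp_neg_ofReal_mul_I t)
    have h2 := mem_ball_zero_iff.1 hx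
    have h3 : 0 < 1 - ρ := by linarith
    gcongr
    linarith
  · refine Filter.Eventually.of_forall fun t x hx => ?_
    have hne := one_sub_mul_ne_zero (hlt x hx) (norm_exp_neg_ofReal_mul_I t)
    have h := (((hasDerivAt_id x).mul_const (Complex.exp (-(t * Complex.I)))).const_sub 1).fun_inv hne
    simpa using h.const_mul (g t)

theorem norm_circleMap_zero_lt {r : ℝ} (hr0 : 0 ≤ r) (hr1 : r < 1) (x : ℝ) :
    ‖circleMap 0 r x‖ < 1 := by
  rw [norm_circleMap_zero, abs_of_nonneg hr0]
  exact hr1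

/-- Mean value property on a circle inside the unit disc. -/
theorem integral_circleMap_eq {F : ℂ → ℂ} (hF : ∀ z : ℂ, ‖z‖ < 1 → DifferentiableAt ℂ F z)
    {r : ℝ} (hr0 : 0 ≤ r) (hr1 : r < 1) :
    ∫ x, F (circleMap 0 r x) ∂periodMeasure = 2 * π * F 0 := by
  have hd : DiffContOnCl ℂ F (Metric.ball 0 |r|) := by
    rw [abs_of_nonneg hr0]
    refine DifferentiableOn.diffContOnCl_ball (U := Metric.ball 0 1) ?_
      (Metric.closedBall_subset_ball hr1)
    exact fun z hz => (hF z (mem_ball_zero_iff.1 hz)).differentiableWithinAt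
  have h := hd.circleAverage
  rw [Real.circleAverage_def, intervalIntegral.integral_of_le (by positivity)] at h
  rw [← h, Complex.real_smul]
  push_cast
  field_simp

theorem continuous_comp_circleMap {E : Type*} [TopologicalSpace E] {F : ℂ → E}
    (hF : ∀ z : ℂ, ‖z‖ < 1 → ContinuousAt F z) {r : ℝ} (hr0 : 0 ≤ r) (hr1 : r < 1) :
    Continuous fun x => F (circleMap 0 r x) :=
  continuous_iff_continuousAt.2 fun x =>
    (hF _ (norm_circleMap_zero_lt hr0 hr1 x)).comp (continuous_circleMap 0 r).continuousAt

theorem Continuous.integrable_periodMeasure {E : Type*} [NormedAddCommGroup E] {F : ℝ → E}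
    (hF : Continuous F) : Integrable F periodMeasure :=
  (hF.integrableOn_Icc (a := 0) (b := 2 * π)).mono_set Set.Ioc_subset_Icc_self

theorem integral_norm_cauchyTransform_rpow_le {p A B : ℝ} (hp : 1 < p) (hB : 0 < B)
    (hAB : ∀ z : ℂ, 0 < z.re → ‖z‖ ^ p ≤ A * z.re ^ p - B * (z ^ (p : ℂ)).re)
    {g : ℝ → ℂ} (hg : Integrable g periodMeasure)
    (hpos : ∀ z : ℂ, ‖z‖ < 1 → 0 < (cauchyTransform g z).re)
    (h0 : (cauchyTransform g 0).im = 0) {r : ℝ} (hr0 : 0 ≤ r) (hr1 : r < 1) :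
    ∫ x, ‖cauchyTransform g (circleMap 0 r x)‖ ^ p ∂periodMeasure ≤
      A * ∫ x, (cauchyTransform g (circleMap 0 r x)).re ^ p ∂periodMeasure := by
  set Φ := cauchyTransform g with hΦ
  have hp0 : 0 ≤ p := by linarith
  have hd : ∀ z : ℂ, ‖z‖ < 1 → DifferentiableAt ℂ Φ z := fun z hz =>
    differentiableAt_cauchyTransform hg hz
  have hdp : ∀ z : ℂ, ‖z‖ < 1 → DifferentiableAt ℂ (fun z => Φ z ^ (p : ℂ)) z := fun z hz =>
    (hd z hz).cpow_const (Or.inl (hpos z hz))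
  have hmean := integral_circleMap_eq hdp hr0 hr1
  have hcont := continuous_comp_circleMap (fun z hz => (hd z hz).continuousAt) hr0 hr1
  have hcontp := continuous_comp_circleMap (fun z hz => (hdp z hz).continuousAt) hr0 hr1
  have hint := hcontp.integrable_periodMeasure
  have hre : 0 ≤ ∫ x, (Φ (circleMap 0 r x) ^ (p : ℂ)).re ∂periodMeasure := by
    have h1 : ∫ x, (Φ (circleMap 0 r x) ^ (p : ℂ)).re ∂periodMeasure
        = (2 * π * Φ 0 ^ (p : ℂ)).re := by
      rw [← hmean]
      exact integral_re hint
    have h2 : Φ 0 = ((Φ 0).re : ℂ) := by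
      apply Complex.ext <;> simp [h0]
    have h3 := hpos 0 (by simp)
    rw [h1, h2, ← Complex.ofReal_cpow h3.le]
    norm_cast
    positivity
  have hi1 : Integrable (fun x => ‖Φ (circleMap 0 r x)‖ ^ p) periodMeasure :=
    (hcont.norm.rpow_const fun _ => Or.inr hp0).integrable_periodMeasure
  have hi2 : Integrable (fun x => (Φ (circleMap 0 r x)).re ^ p) periodMeasure :=
    ((Complex.continuous_re.comp hcont).rpow_const fun _ => Or.inr hp0).integrable_periodMeasure
  have hi3 : Integrable (fun x => (Φ (circleMap 0 r x) ^ (p : ℂ)).re) periodMeasure := hint.re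
  calc _ ≤ ∫ x, (A * (Φ (circleMap 0 r x)).re ^ p - B * (Φ (circleMap 0 r x) ^ (p : ℂ)).re)
        ∂periodMeasure :=
        integral_mono hi1 ((hi2.const_mul A).sub (hi3.const_mul B)) fun x =>
          hAB _ (hpos _ (norm_circleMap_zero_lt hr0 hr1 x))
    _ = A * ∫ x, (Φ (circleMap 0 r x)).re ^ p ∂periodMeasure
        - B * ∫ x, (Φ (circleMap 0 r x) ^ (p : ℂ)).re ∂periodMeasure := by
        rw [integral_sub (hi2.const_mul A) (hi3.const_mul B), integral_const_mul,
          integral_const_mul]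
    _ ≤ _ := by nlinarith

theorem norm_mul_exp_neg_lt {z : ℂ} (hz : ‖z‖ < 1) (t : ℝ) :
    ‖z * Complex.exp (-(t * Complex.I))‖ < 1 := by
  rwa [norm_mul, norm_exp_neg_ofReal_mul_I, mul_one]

theorem re_cauchyKernel_symm (r x t : ℝ) :
    ((1 - circleMap 0 r x * Complex.exp (-(t * Complex.I)))⁻¹).re =
      ((1 - circleMap 0 r t * Complex.exp (-(x * Complex.I)))⁻¹).re := by
  rw [← Complex.conj_re ((1 - circleMap 0 r t * Complex.exp (-(x * Complex.I)))⁻¹), map_inv₀]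
  congr 2
  simp only [circleMap, zero_add, map_sub, map_one, map_mul, Complex.conj_ofReal,
    ← Complex.exp_conj, map_neg, Complex.conj_I]
  ring_nf

theorem lintegral_re_cauchyKernel {r : ℝ} (hr0 : 0 ≤ r) (hr1 : r < 1) (t : ℝ) :
    ∫⁻ x, ENNReal.ofReal ((1 - circleMap 0 r x * Complex.exp (-(t * Complex.I)))⁻¹).re
      ∂periodMeasure = ENNReal.ofReal (2 * π) := by
  have hd : ∀ z : ℂ, ‖z‖ < 1 →
      DifferentiableAt ℂ (fun z => (1 - z * Complex.exp (-(t * Complex.I)))⁻¹) z := fun z hz =>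
    DifferentiableAt.fun_inv (by fun_prop) (one_sub_mul_ne_zero hz (norm_exp_neg_ofReal_mul_I t))
  have hint := (continuous_comp_circleMap (fun z hz => (hd z hz).continuousAt) hr0
    hr1).integrable_periodMeasure
  have hre : Integrable (fun x =>
    ((1 - circleMap 0 r x * Complex.exp (-(t * Complex.I)))⁻¹).re) periodMeasure := hint.re
  rw [← ofReal_integral_eq_lintegral_ofReal hre]
  · congr 1
    have h := integral_circleMap_eq hd hr0 hr1
    have h2 := congrArg Complex.re h
    rw [show (∫ x, (1 - circleMap 0 r x * Complex.exp (-(t * Complex.I)))⁻¹ ∂periodMeasure).re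
      = ∫ x, ((1 - circleMap 0 r x * Complex.exp (-(t * Complex.I)))⁻¹).re ∂periodMeasure
      from (integral_re hint).symm] at h2
    rw [h2]
    simp
  · exact Filter.Eventually.of_forall fun x =>
      (re_inv_one_sub_pos (norm_mul_exp_neg_lt (norm_circleMap_zero_lt hr0 hr1 x) t)).le

theorem re_cauchyTransform_ofReal {g : ℝ → ℝ} (hg : Integrable g periodMeasure) {z : ℂ}
    (hz : ‖z‖ < 1) :
    (cauchyTransform (fun t => (g t : ℂ)) z).re =
      ∫ t, g t * ((1 - z * Complex.exp (-(t * Complex.I)))⁻¹).re ∂periodMeasure := by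
  have h := integral_re (integrable_mul_cauchyKernel hg.ofReal hz)
  rw [cauchyTransform]
  refine Eq.trans h.symm (integral_congr_ae (Filter.Eventually.of_forall fun t => ?_))
  exact Complex.re_ofReal_mul _ _

theorem lintegral_re_cauchyTransform_rpow_le {p : ℝ} (hp : 1 < p) {g : ℝ → ℝ}
    (hg : Integrable g periodMeasure) (hg0 : ∀ t, 0 ≤ g t) {r : ℝ} (hr0 : 0 ≤ r) (hr1 : r < 1) :
    ∫⁻ x, ENNReal.ofReal (cauchyTransform (fun t => (g t : ℂ)) (circleMap 0 r x)).re ^ p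
      ∂periodMeasure ≤
      ENNReal.ofReal (2 * π) ^ p * ∫⁻ t, ENNReal.ofReal (g t) ^ p ∂periodMeasure := by
  have hker : ∀ x t : ℝ, 0 < ((1 - circleMap 0 r x * Complex.exp (-(t * Complex.I)))⁻¹).re :=
    fun x t => re_inv_one_sub_pos (norm_mul_exp_neg_lt (norm_circleMap_zero_lt hr0 hr1 x) t)
  have hrw : ∀ x, ENNReal.ofReal (cauchyTransform (fun t => (g t : ℂ)) (circleMap 0 r x)).re =
      ∫⁻ t, ENNReal.ofReal ((1 - circleMap 0 r x * Complex.exp (-(t * Complex.I)))⁻¹).re *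
        ENNReal.ofReal (g t) ∂periodMeasure := fun x => by
    have hz := norm_circleMap_zero_lt hr0 hr1 x
    rw [re_cauchyTransform_ofReal hg hz, ofReal_integral_eq_lintegral_ofReal]
    · refine lintegral_congr fun t => ?_
      rw [mul_comm, ENNReal.ofReal_mul (hker x t).le]
    · refine (integrable_mul_cauchyKernel hg.ofReal hz).re.congr
        (Filter.Eventually.of_forall fun t => ?_)
      exact Complex.re_ofReal_mul _ _
    · exact Filter.Eventually.of_forall fun t => mul_nonneg (hg0 t) (hker x t).le
  simp_rw [hrw]
  refine lintegral_lintegral_mul_rpow_le_of_schur hp ?_ hg.aemeasurable.ennreal_ofReal ?_ ?_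
  · refine Measurable.ennreal_ofReal (Complex.measurable_re.comp (Measurable.inv ?_))
    have : Continuous fun z : ℝ × ℝ =>
      1 - circleMap 0 r z.1 * Complex.exp (-(z.2 * Complex.I)) := by
      have := continuous_circleMap 0 r
      fun_prop
    exact this.measurable
  · intro x
    simp_rw [re_cauchyKernel_symm r x]
    exact (lintegral_re_cauchyKernel hr0 hr1 x).le
  · exact fun t => (lintegral_re_cauchyKernel hr0 hr1 t).le

theorem cauchyTransform_congr_ae {g h : ℝ → ℂ} (hgh : g =ᵐ[periodMeasure] h) (z : ℂ) :
    cauchyTransform g z = cauchyTransform h z :=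
  integral_congr_ae (hgh.mono fun t ht => by simp only [ht])

theorem continuous_cauchyTransform_circleMap {g : ℝ → ℂ} (hg : Integrable g periodMeasure)
    {r : ℝ} (hr0 : 0 ≤ r) (hr1 : r < 1) :
    Continuous fun x => cauchyTransform g (circleMap 0 r x) :=
  continuous_comp_circleMap (fun _ hz => (differentiableAt_cauchyTransform hg hz).continuousAt)
    hr0 hr1

theorem lintegral_enorm_cauchyTransform_rpow_le_of_nonneg {p A B : ℝ} (hp : 1 < p) (hA : 0 < A)
    (hB : 0 < B) (hAB : ∀ z : ℂ, 0 < z.re → ‖z‖ ^ p ≤ A * z.re ^ p - B * (z ^ (p : ℂ)).re)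
    {g : ℝ → ℝ} (hg : Integrable g periodMeasure) (hg0 : ∀ t, 0 ≤ g t)
    {r : ℝ} (hr0 : 0 ≤ r) (hr1 : r < 1) :
    ∫⁻ x, ‖cauchyTransform (fun t => (g t : ℂ)) (circleMap 0 r x)‖ₑ ^ p ∂periodMeasure ≤
      ENNReal.ofReal A * (ENNReal.ofReal (2 * π) ^ p * ∫⁻ t, ‖g t‖ₑ ^ p ∂periodMeasure) := by
  have hp0 : 0 < p := by linarith
  by_cases hzero : g =ᵐ[periodMeasure] 0
  · have h0 : ∀ z, cauchyTransform (fun t => (g t : ℂ)) z = 0 := fun z => by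
      rw [cauchyTransform_congr_ae (h := fun _ => 0) (hzero.mono fun t ht => by simp [ht])]
      simp [cauchyTransform]
    simp [h0, hp0]
  have hker : ∀ z : ℂ, ‖z‖ < 1 → ∀ t : ℝ,
      0 < ((1 - z * Complex.exp (-(t * Complex.I)))⁻¹).re :=
    fun z hz t => re_inv_one_sub_pos (norm_mul_exp_neg_lt hz t)
  have hpos : ∀ z : ℂ, ‖z‖ < 1 → 0 < (cauchyTransform (fun t => (g t : ℂ)) z).re := by
    intro z hz
    rw [re_cauchyTransform_ofReal hg hz]
    have hi : Integrable (fun t : ℝ => g t * ((1 - z * Complex.exp (-(t * Complex.I)))⁻¹).re)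
        periodMeasure := by
      refine (integrable_mul_cauchyKernel hg.ofReal hz).re.congr
        (Filter.Eventually.of_forall fun t => ?_)
      exact Complex.re_ofReal_mul _ _
    have hnn : ∀ t : ℝ, 0 ≤ g t * ((1 - z * Complex.exp (-(t * Complex.I)))⁻¹).re :=
      fun t => mul_nonneg (hg0 t) (hker z hz t).le
    refine (integral_nonneg hnn).lt_of_ne' fun h => hzero ?_
    filter_upwards [(integral_eq_zero_iff_of_nonneg hnn hi).1 h] with t ht
    exact (mul_eq_zero.1 ht).resolve_right (hker z hz t).ne'
  have h0 : (cauchyTransform (fun t => (g t : ℂ)) 0).im = 0 := by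
    have : cauchyTransform (fun t => (g t : ℂ)) 0 = ((∫ t, g t ∂periodMeasure : ℝ) : ℂ) := by
      simp only [cauchyTransform, zero_mul, sub_zero, inv_one, mul_one]
      exact integral_ofReal
    rw [this, Complex.ofReal_im]
  have hgc : Integrable (fun t => (g t : ℂ)) periodMeasure := hg.ofReal
  have hmain := integral_norm_cauchyTransform_rpow_le hp hB hAB hgc hpos h0 hr0 hr1
  have hcont := continuous_cauchyTransform_circleMap hgc hr0 hr1
  have hi1 : Integrable (fun x => ‖cauchyTransform (fun t => (g t : ℂ)) (circleMap 0 r x)‖ ^ p)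
      periodMeasure := (hcont.norm.rpow_const fun _ => Or.inr hp0.le).integrable_periodMeasure
  have hi2 : Integrable (fun x => (cauchyTransform (fun t => (g t : ℂ)) (circleMap 0 r x)).re ^ p)
      periodMeasure :=
    ((Complex.continuous_re.comp hcont).rpow_const fun _ => Or.inr hp0.le).integrable_periodMeasure
  have hposx := fun x => hpos _ (norm_circleMap_zero_lt hr0 hr1 x)
  calc _ = ENNReal.ofReal
        (∫ x, ‖cauchyTransform (fun t => (g t : ℂ)) (circleMap 0 r x)‖ ^ p ∂periodMeasure) := by
        rw [ofReal_integral_eq_lintegral_ofReal hi1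
          (Filter.Eventually.of_forall fun x => by positivity)]
        refine lintegral_congr fun x => ?_
        rw [← ofReal_norm, ENNReal.ofReal_rpow_of_nonneg (norm_nonneg _) hp0.le]
    _ ≤ _ := ENNReal.ofReal_le_ofReal hmain
    _ = ENNReal.ofReal A * ∫⁻ x, ENNReal.ofReal
        (cauchyTransform (fun t => (g t : ℂ)) (circleMap 0 r x)).re ^ p ∂periodMeasure := by
        rw [ENNReal.ofReal_mul hA.le, ofReal_integral_eq_lintegral_ofReal hi2
          (Filter.Eventually.of_forall fun x => Real.rpow_nonneg (hposx x).le _)]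
        congr 1
        refine lintegral_congr fun x => ?_
        rw [ENNReal.ofReal_rpow_of_nonneg (hposx x).le hp0.le]
    _ ≤ _ := by
        gcongr 1
        refine (lintegral_re_cauchyTransform_rpow_le hp hg hg0 hr0 hr1).trans_eq ?_
        congr 1
        refine lintegral_congr fun t => ?_
        rw [Real.enorm_of_nonneg (hg0 t)]

theorem eLpNorm_ofReal_eq_lintegral {β E : Type*} [MeasurableSpace β] [NormedAddCommGroup E]
    {ν : Measure β} {p : ℝ} (hp : 0 < p) (f : β → E) :
    eLpNorm f (ENNReal.ofReal p) ν = (∫⁻ x, ‖f x‖ₑ ^ p ∂ν) ^ (1 / p) := by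
  rw [eLpNorm_eq_lintegral_rpow_enorm_toReal (by simpa using hp) ENNReal.ofReal_ne_top,
    ENNReal.toReal_ofReal hp.le]

theorem MemLp.integrable_periodMeasure {E : Type*} [NormedAddCommGroup E] {p : ℝ} (hp : 1 < p)
    {f : ℝ → E} (hf : MemLp f (ENNReal.ofReal p) periodMeasure) : Integrable f periodMeasure :=
  hf.integrable (by simpa using hp.le)

theorem exists_eLpNorm_cauchyTransform_le_of_nonneg {p : ℝ} (hp : 1 < p) (hp2 : p ≤ 2) :
    ∃ A : ℝ≥0, ∀ g : ℝ → ℝ, MemLp g (ENNReal.ofReal p) periodMeasure → (∀ t, 0 ≤ g t) →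
      ∀ r : ℝ, 0 ≤ r → r < 1 →
        eLpNorm (fun x => cauchyTransform (fun t => (g t : ℂ)) (circleMap 0 r x))
          (ENNReal.ofReal p) periodMeasure ≤ A * eLpNorm g (ENNReal.ofReal p) periodMeasure := by
  obtain ⟨A, B, hA, hB, hAB⟩ := exists_norm_rpow_le_re_rpow_sub_re_cpow hp hp2
  have hp0 : 0 < p := by linarith
  refine ⟨(A ^ (1 / p) * (2 * π)).toNNReal, fun g hg hg0 r hr0 hr1 => ?_⟩
  have h := lintegral_enorm_cauchyTransform_rpow_le_of_nonneg hp hA hB hAB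
    (MemLp.integrable_periodMeasure hp hg) hg0 hr0 hr1
  rw [eLpNorm_ofReal_eq_lintegral hp0, eLpNorm_ofReal_eq_lintegral hp0]
  refine (ENNReal.rpow_le_rpow h (by positivity)).trans_eq ?_
  have hq : 0 ≤ 1 / p := by positivity
  rw [ENNReal.mul_rpow_of_nonneg _ _ hq, ENNReal.mul_rpow_of_nonneg _ _ hq, ← ENNReal.rpow_mul,
    mul_one_div_cancel hp0.ne', ENNReal.rpow_one, ENNReal.ofReal_rpow_of_pos hA, ← mul_assoc,
    ← ENNReal.ofReal_mul (by positivity)]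
  rfl

theorem cauchyTransform_sub {g h : ℝ → ℂ} (hg : Integrable g periodMeasure)
    (hh : Integrable h periodMeasure) {z : ℂ} (hz : ‖z‖ < 1) :
    cauchyTransform (fun t => g t - h t) z = cauchyTransform g z - cauchyTransform h z := by
  simp only [cauchyTransform, sub_mul]
  exact integral_sub (integrable_mul_cauchyKernel hg hz) (integrable_mul_cauchyKernel hh hz)

theorem cauchyTransform_add {g h : ℝ → ℂ} (hg : Integrable g periodMeasure)
    (hh : Integrable h periodMeasure) {z : ℂ} (hz : ‖z‖ < 1) :
    cauchyTransform (fun t => g t + h t) z = cauchyTransform g z + cauchyTransform h z := by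
  simp only [cauchyTransform, add_mul]
  exact integral_add (integrable_mul_cauchyKernel hg hz) (integrable_mul_cauchyKernel hh hz)

theorem cauchyTransform_const_mul (c : ℂ) (g : ℝ → ℂ) (z : ℂ) :
    cauchyTransform (fun t => c * g t) z = c * cauchyTransform g z := by
  simp only [cauchyTransform, mul_assoc]
  exact integral_const_mul _ _

theorem exists_eLpNorm_cauchyTransform_ofReal_le {p : ℝ} (hp : 1 < p) (hp2 : p ≤ 2) :
    ∃ A : ℝ≥0, ∀ g : ℝ → ℝ, MemLp g (ENNReal.ofReal p) periodMeasure →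
      ∀ r : ℝ, 0 ≤ r → r < 1 →
        eLpNorm (fun x => cauchyTransform (fun t => (g t : ℂ)) (circleMap 0 r x))
          (ENNReal.ofReal p) periodMeasure ≤ A * eLpNorm g (ENNReal.ofReal p) periodMeasure := by
  obtain ⟨A, hA⟩ := exists_eLpNorm_cauchyTransform_le_of_nonneg hp hp2
  refine ⟨A + A, fun g hg r hr0 hr1 => ?_⟩
  have hp1 : 1 ≤ ENNReal.ofReal p := by simpa using hp.le
  have hpos : MemLp (fun t => max (g t) 0) (ENNReal.ofReal p) periodMeasure := hg.pos_part
  have hneg : MemLp (fun t => max (-g t) 0) (ENNReal.ofReal p) periodMeasure := hg.neg_part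
  have hposi : Integrable (fun t => ((max (g t) 0 : ℝ) : ℂ)) periodMeasure :=
    (MemLp.integrable_periodMeasure hp hpos).ofReal
  have hnegi : Integrable (fun t => ((max (-g t) 0 : ℝ) : ℂ)) periodMeasure :=
    (MemLp.integrable_periodMeasure hp hneg).ofReal
  have hsplit : (fun t => (g t : ℂ)) =
      fun t => ((max (g t) 0 : ℝ) : ℂ) - ((max (-g t) 0 : ℝ) : ℂ) := by
    funext t
    rw [← Complex.ofReal_sub, max_zero_sub_max_neg_zero_eq_self]
  have heq : (fun x => cauchyTransform (fun t => (g t : ℂ)) (circleMap 0 r x)) =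
      (fun x => cauchyTransform (fun t => ((max (g t) 0 : ℝ) : ℂ)) (circleMap 0 r x)) -
      fun x => cauchyTransform (fun t => ((max (-g t) 0 : ℝ) : ℂ)) (circleMap 0 r x) := by
    funext x
    rw [hsplit, cauchyTransform_sub hposi hnegi (norm_circleMap_zero_lt hr0 hr1 x)]
    rfl
  rw [heq]
  refine (eLpNorm_sub_le
    (continuous_cauchyTransform_circleMap hposi hr0 hr1).aestronglyMeasurable
    (continuous_cauchyTransform_circleMap hnegi hr0 hr1).aestronglyMeasurable hp1).trans ?_
  rw [ENNReal.coe_add, add_mul]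
  gcongr
  · refine (hA _ hpos (fun t => le_max_right _ _) r hr0 hr1).trans ?_
    gcongr
    refine eLpNorm_mono fun t => ?_
    rw [Real.norm_of_nonneg (le_max_right _ _), Real.norm_eq_abs]
    exact max_le (le_abs_self _) (abs_nonneg _)
  · refine (hA _ hneg (fun t => le_max_right _ _) r hr0 hr1).trans ?_
    gcongr
    refine eLpNorm_mono fun t => ?_
    rw [Real.norm_of_nonneg (le_max_right _ _), Real.norm_eq_abs]
    exact max_le (neg_le_abs _) (abs_nonneg _)

/-- The Cauchy transform is bounded on `L^p`, uniformly over circles inside the unit disc. -/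
theorem exists_eLpNorm_cauchyTransform_le {p : ℝ} (hp : 1 < p) (hp2 : p ≤ 2) :
    ∃ A : ℝ≥0, ∀ g : ℝ → ℂ, MemLp g (ENNReal.ofReal p) periodMeasure →
      ∀ r : ℝ, 0 ≤ r → r < 1 →
        eLpNorm (fun x => cauchyTransform g (circleMap 0 r x))
          (ENNReal.ofReal p) periodMeasure ≤ A * eLpNorm g (ENNReal.ofReal p) periodMeasure := by
  obtain ⟨A, hA⟩ := exists_eLpNorm_cauchyTransform_ofReal_le hp hp2
  refine ⟨A + A, fun g hg r hr0 hr1 => ?_⟩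
  have hp1 : 1 ≤ ENNReal.ofReal p := by simpa using hp.le
  have hre : MemLp (fun t => (g t).re) (ENNReal.ofReal p) periodMeasure := hg.re
  have him : MemLp (fun t => (g t).im) (ENNReal.ofReal p) periodMeasure := hg.im
  have hrei : Integrable (fun t => ((g t).re : ℂ)) periodMeasure :=
    (MemLp.integrable_periodMeasure hp hre).ofReal
  have himi : Integrable (fun t => ((g t).im : ℂ)) periodMeasure :=
    (MemLp.integrable_periodMeasure hp him).ofReal
  have hsplit : g = fun t => ((g t).re : ℂ) + Complex.I * ((g t).im : ℂ) := by
    funext t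
    rw [mul_comm, Complex.re_add_im]
  have heq : (fun x => cauchyTransform g (circleMap 0 r x)) =
      (fun x => cauchyTransform (fun t => ((g t).re : ℂ)) (circleMap 0 r x)) +
      Complex.I • fun x => cauchyTransform (fun t => ((g t).im : ℂ)) (circleMap 0 r x) := by
    funext x
    conv_lhs => rw [hsplit]
    rw [cauchyTransform_add hrei (himi.const_mul _) (norm_circleMap_zero_lt hr0 hr1 x),
      cauchyTransform_const_mul]
    rfl
  rw [heq]
  refine (eLpNorm_add_le
    (continuous_cauchyTransform_circleMap hrei hr0 hr1).aestronglyMeasurable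
    ((continuous_cauchyTransform_circleMap himi hr0 hr1).aestronglyMeasurable.const_smul _)
    hp1).trans ?_
  rw [ENNReal.coe_add, add_mul, eLpNorm_const_smul]
  simp only [enorm_eq_nnnorm, Complex.nnnorm_I, ENNReal.coe_one, one_mul]
  gcongr
  · refine (hA _ hre r hr0 hr1).trans ?_
    gcongr
    exact eLpNorm_mono fun t => Complex.abs_re_le_norm _
  · refine (hA _ him r hr0 hr1).trans ?_
    gcongr
    exact eLpNorm_mono fun t => Complex.abs_im_le_norm _

theorem sum_exp_eq_two_mul_dirichletKernel (n : ℕ) (u : ℝ) :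
    ∑ k ∈ Finset.range (2 * n + 1), Complex.exp (((k : ℂ) - n) * u * Complex.I) =
      2 * (dirichletKernel n u : ℂ) := by
  induction n with
  | zero => simp [dirichletKernel]
  | succ n ih =>
    have hD : dirichletKernel (n + 1) u = dirichletKernel n u + Real.cos ((n + 1 : ℕ) * u) := by
      rw [dirichletKernel, dirichletKernel, Finset.sum_Icc_succ_top (by omega), add_assoc]
    rw [show 2 * (n + 1) + 1 = (2 * n + 1) + 1 + 1 by ring, Finset.sum_range_succ,
      Finset.sum_range_succ', hD]
    have hshift : ∀ k : ℕ, Complex.exp ((((k + 1 : ℕ) : ℂ) - (n + 1 : ℕ)) * u * Complex.I) =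
        Complex.exp (((k : ℂ) - n) * u * Complex.I) := fun k => by
      congr 3
      push_cast
      ring
    simp only [hshift]
    rw [ih]
    push_cast
    rw [mul_add, Complex.two_cos, add_assoc, add_comm (Complex.exp _) (Complex.exp _)]
    congr 3 <;> ring

theorem continuous_dirichletKernel (n : ℕ) : Continuous (dirichletKernel n) := by
  unfold dirichletKernel
  fun_prop

theorem partialFourierSum_eq (f : ℝ → ℝ) (n : ℕ) (x : ℝ) :
    partialFourierSum f n x = (1 / π) * ∫ t, f t * dirichletKernel n (x - t) ∂periodMeasure := by
  rw [partialFourierSum, intervalIntegral.integral_of_le (by positivity)]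

theorem norm_exp_real_mul_I (a b : ℝ) : ‖Complex.exp (a * b * Complex.I)‖ = 1 := by
  rw [← Complex.ofReal_mul, Complex.norm_exp_ofReal_mul_I]

/-- The kernel `∑_{k ≤ 2n} r^k e^{i(k-n)u}` applied to `f`: an Abel-weighted partial Fourier
sum. -/
noncomputable def weightedFourierSum (f : ℝ → ℝ) (n : ℕ) (r x : ℝ) : ℂ :=
  ∑ k ∈ Finset.range (2 * n + 1), (r : ℂ) ^ k *
    ∫ t, (f t : ℂ) * Complex.exp (((k : ℂ) - n) * (x - t : ℝ) * Complex.I) ∂periodMeasure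

theorem integrable_mul_exp {f : ℝ → ℝ} (hf : Integrable f periodMeasure) (a : ℂ) (x : ℝ) :
    Integrable (fun t => (f t : ℂ) * Complex.exp (a * (x - t : ℝ) * Complex.I)) periodMeasure := by
  have hc : Continuous fun t : ℝ => Complex.exp (a * (x - t : ℝ) * Complex.I) := by fun_prop
  obtain ⟨M, hM⟩ := (isCompact_Icc (a := (0 : ℝ)) (b := 2 * π)).exists_bound_of_continuousOn
    hc.continuousOn
  have hfc : Integrable (fun t => (f t : ℂ)) periodMeasure := hf.ofReal
  refine hfc.mul_bdd (c := M) hc.aestronglyMeasurable ?_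
  filter_upwards [ae_restrict_mem measurableSet_Ioc] with t ht
  exact hM t (Set.Ioc_subset_Icc_self ht)

theorem weightedFourierSum_one {f : ℝ → ℝ} (hf : Integrable f periodMeasure) (n : ℕ) (x : ℝ) :
    weightedFourierSum f n 1 x = 2 * π * (partialFourierSum f n x : ℂ) := by
  simp only [weightedFourierSum, Complex.ofReal_one, one_pow, one_mul]
  rw [← integral_finsetSum _ fun k _ => integrable_mul_exp hf _ x]
  simp_rw [← Finset.mul_sum, sum_exp_eq_two_mul_dirichletKernel]
  rw [partialFourierSum_eq, Complex.ofReal_mul, ← integral_complex_ofReal, ← mul_assoc,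
    ← integral_const_mul]
  refine integral_congr_ae (Filter.Eventually.of_forall fun t => ?_)
  have := Real.pi_ne_zero
  push_cast
  field_simp

theorem weightedFourierSum_eq_cauchyTransform {f : ℝ → ℝ} (hf : Integrable f periodMeasure)
    (n : ℕ) {r : ℝ} (hr0 : 0 ≤ r) (hr1 : r < 1) (x : ℝ) :
    weightedFourierSum f n r x = Complex.exp (-(n * x * Complex.I)) *
      (cauchyTransform (fun t => f t * Complex.exp (n * t * Complex.I)) (circleMap 0 r x) -
        circleMap 0 r x ^ (2 * n + 1) *
        cauchyTransform (fun t => f t * Complex.exp (-((n + 1) * t * Complex.I)))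
          (circleMap 0 r x)) := by
  have hz := norm_circleMap_zero_lt hr0 hr1 x
  have h1 : Integrable (fun t => f t * Complex.exp (n * t * Complex.I)) periodMeasure := by
    refine (integrable_mul_exp hf (-n) 0).congr (Filter.Eventually.of_forall fun t => ?_)
    simp
  have h2 : Integrable (fun t => f t * Complex.exp (-((n + 1) * t * Complex.I)))
      periodMeasure := by
    refine (integrable_mul_exp hf (n + 1) 0).congr (Filter.Eventually.of_forall fun t => ?_)
    simp
  rw [weightedFourierSum, cauchyTransform, cauchyTransform, ← integral_const_mul,
    ← integral_sub (integrable_mul_cauchyKernel h1 hz)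
      ((integrable_mul_cauchyKernel h2 hz).const_mul _), ← integral_const_mul]
  simp_rw [← integral_const_mul]
  rw [← integral_finsetSum _ fun k _ => (integrable_mul_exp hf _ x).const_mul _]
  refine integral_congr_ae (Filter.Eventually.of_forall fun t => ?_)
  set w := circleMap 0 r x * Complex.exp (-(t * Complex.I)) with hw
  have hne : 1 - w ≠ 0 := one_sub_mul_ne_zero hz (norm_exp_neg_ofReal_mul_I t)
  have hwx : w = r * Complex.exp ((x - t : ℝ) * Complex.I) := by
    rw [hw, circleMap, zero_add, mul_assoc, ← Complex.exp_add]
    push_cast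
    ring_nf
  have hterm : ∀ k : ℕ, (r : ℂ) ^ k *
      ((f t : ℂ) * Complex.exp (((k : ℂ) - n) * (x - t : ℝ) * Complex.I)) =
      f t * Complex.exp (-(n * (x - t : ℝ) * Complex.I)) * w ^ k := fun k => by
    rw [hwx, mul_pow, ← Complex.exp_nat_mul, show ((k : ℂ) - n) * (x - t : ℝ) * Complex.I =
      -(n * (x - t : ℝ) * Complex.I) + k * ((x - t : ℝ) * Complex.I) by ring, Complex.exp_add]
    ring
  have hgeom : ∑ k ∈ Finset.range (2 * n + 1), w ^ k = (1 - w ^ (2 * n + 1)) * (1 - w)⁻¹ := by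
    rw [eq_mul_inv_iff_mul_eq₀ hne, geom_sum_mul_neg]
  have hpow : circleMap 0 r x ^ (2 * n + 1) * Complex.exp (-((n + 1) * t * Complex.I)) =
      w ^ (2 * n + 1) * Complex.exp (n * t * Complex.I) := by
    rw [hw, mul_pow, ← Complex.exp_nat_mul, mul_assoc (circleMap 0 r x ^ (2 * n + 1)),
      ← Complex.exp_add]
    push_cast
    ring_nf
  have hexp : Complex.exp (-(n * (x - t : ℝ) * Complex.I)) =
      Complex.exp (-(n * x * Complex.I)) * Complex.exp (n * t * Complex.I) := by
    rw [← Complex.exp_add]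
    push_cast
    ring_nf
  simp only [hterm]
  rw [← Finset.mul_sum, hgeom, hexp]
  linear_combination (Complex.exp (-(n * x * Complex.I)) * f t * (1 - w)⁻¹) * hpow

theorem continuous_partialFourierSum {f : ℝ → ℝ} (hf : Integrable f periodMeasure) (n : ℕ) :
    Continuous (partialFourierSum f n) := by
  have hterm : ∀ (c : ℝ) (x : ℝ), ∫ t, f t * Real.cos (c * (x - t)) ∂periodMeasure =
      Real.cos (c * x) * ∫ t, f t * Real.cos (c * t) ∂periodMeasure +
        Real.sin (c * x) * ∫ t, f t * Real.sin (c * t) ∂periodMeasure := by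
    intro c x
    rw [← integral_const_mul, ← integral_const_mul, ← integral_add]
    · refine integral_congr_ae (Filter.Eventually.of_forall fun t => ?_)
      simp only [mul_sub, Real.cos_sub]
      ring
    · exact (hf.mul_bdd (c := 1) (Continuous.aestronglyMeasurable (by fun_prop))
        (Filter.Eventually.of_forall fun t => Real.abs_cos_le_one _)).const_mul _
    · exact (hf.mul_bdd (c := 1) (Continuous.aestronglyMeasurable (by fun_prop))
        (Filter.Eventually.of_forall fun t => Real.abs_sin_le_one _)).const_mul _
  have heq : partialFourierSum f n = fun x => (1 / π) *
      ((∫ t, f t ∂periodMeasure) * (1 / 2) + ∑ k ∈ Finset.Icc 1 n,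
        (Real.cos (k * x) * ∫ t, f t * Real.cos (k * t) ∂periodMeasure +
        Real.sin (k * x) * ∫ t, f t * Real.sin (k * t) ∂periodMeasure)) := by
    funext x
    rw [partialFourierSum_eq]
    simp only [dirichletKernel, mul_add, Finset.mul_sum]
    have hint : ∀ k : ℕ, Integrable (fun t => f t * Real.cos (k * (x - t))) periodMeasure :=
      fun k => hf.mul_bdd (c := 1) (Continuous.aestronglyMeasurable (by fun_prop))
        (Filter.Eventually.of_forall fun t => Real.abs_cos_le_one _)
    rw [integral_add (hf.mul_const _) (integrable_finsetSum _ fun k _ => hint k),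
      integral_finsetSum _ fun k _ => hint k, integral_mul_const]
    simp only [hterm, mul_add, Finset.mul_sum]
  rw [heq]
  fun_prop

theorem exists_eLpNorm_partialFourierSum_le_of_le_two {p : ℝ} (hp : 1 < p) (hp2 : p ≤ 2) :
    ∃ A : ℝ≥0, ∀ f : ℝ → ℝ, MemLp f (ENNReal.ofReal p) periodMeasure → ∀ n : ℕ,
      eLpNorm (partialFourierSum f n) (ENNReal.ofReal p) periodMeasure ≤
        A * eLpNorm f (ENNReal.ofReal p) periodMeasure := by
  obtain ⟨A, hA⟩ := exists_eLpNorm_cauchyTransform_le hp hp2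
  have hp1 : 1 ≤ ENNReal.ofReal p := by simpa using hp.le
  refine ⟨A + A, fun f hf n => ?_⟩
  have hfi := MemLp.integrable_periodMeasure hp hf
  have hmod : ∀ e : ℝ → ℂ, Continuous e → (∀ t, ‖e t‖ = 1) →
      MemLp (fun t => f t * e t) (ENNReal.ofReal p) periodMeasure ∧
      eLpNorm (fun t => f t * e t) (ENNReal.ofReal p) periodMeasure =
        eLpNorm f (ENNReal.ofReal p) periodMeasure := fun e he h1 => by
    have hn : ∀ t, ‖(f t : ℂ) * e t‖ = ‖f t‖ := fun t => by simp [h1]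
    refine ⟨hf.congr_norm ?_ (Filter.Eventually.of_forall fun t => (hn t).symm),
      eLpNorm_congr_norm_ae (Filter.Eventually.of_forall hn)⟩
    exact (Complex.continuous_ofReal.comp_aestronglyMeasurable hf.1).mul he.aestronglyMeasurable
  obtain ⟨hm1, he1⟩ := hmod (fun t => Complex.exp (n * t * Complex.I)) (by fun_prop)
    fun t => by exact_mod_cast norm_exp_real_mul_I n t
  obtain ⟨hm2, he2⟩ := hmod (fun t => Complex.exp (-((n + 1) * t * Complex.I))) (by fun_prop)
    fun t => by
      have := norm_exp_real_mul_I (-(n + 1)) t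
      push_cast at this
      rwa [← neg_mul, ← neg_mul]
  have hbound : ∀ r : ℝ, 0 ≤ r → r < 1 →
      eLpNorm (weightedFourierSum f n r) (ENNReal.ofReal p) periodMeasure ≤
        (A + A : ℝ≥0) * eLpNorm f (ENNReal.ofReal p) periodMeasure := by
    intro r hr0 hr1
    set g₁ : ℝ → ℂ := fun t => f t * Complex.exp (n * t * Complex.I)
    set g₂ : ℝ → ℂ := fun t => f t * Complex.exp (-((n + 1) * t * Complex.I))
    have hc1 := continuous_cauchyTransform_circleMap (MemLp.integrable_periodMeasure hp hm1) hr0 hr1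
    have hc2 := continuous_cauchyTransform_circleMap (MemLp.integrable_periodMeasure hp hm2) hr0 hr1
    calc _ ≤ eLpNorm ((fun x => ‖cauchyTransform g₁ (circleMap 0 r x)‖) +
          fun x => ‖cauchyTransform g₂ (circleMap 0 r x)‖) (ENNReal.ofReal p) periodMeasure := by
          refine eLpNorm_mono_real fun x => ?_
          rw [weightedFourierSum_eq_cauchyTransform hfi n hr0 hr1, norm_mul]
          have hone : ‖Complex.exp (-(n * x * Complex.I))‖ = 1 := by
            have := norm_exp_real_mul_I (-n) x
            push_cast at this
            rwa [← neg_mul, ← neg_mul]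
          rw [hone, one_mul]
          refine (norm_sub_le _ _).trans (add_le_add le_rfl ?_)
          rw [norm_mul, norm_pow]
          exact mul_le_of_le_one_left (norm_nonneg _)
            (pow_le_one₀ (norm_nonneg _) (norm_circleMap_zero_lt hr0 hr1 x).le)
      _ ≤ _ := (eLpNorm_add_le hc1.norm.aestronglyMeasurable hc2.norm.aestronglyMeasurable hp1)
      _ ≤ _ := by
          rw [eLpNorm_norm, eLpNorm_norm, ENNReal.coe_add, add_mul]
          exact add_le_add ((hA g₁ hm1 r hr0 hr1).trans_eq (by rw [he1]))
            ((hA g₂ hm2 r hr0 hr1).trans_eq (by rw [he2]))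
  have hr : Filter.Tendsto (fun j : ℕ => (j : ℝ) / (j + 1)) Filter.atTop (nhds 1) :=
    tendsto_natCast_div_add_atTop 1
  have hr0 : ∀ j : ℕ, 0 ≤ (j : ℝ) / (j + 1) := fun j => by positivity
  have hr1 : ∀ j : ℕ, (j : ℝ) / (j + 1) < 1 := fun j => by
    rw [div_lt_one (by positivity)]
    linarith
  have hlim : ∀ x, Filter.Tendsto (fun j : ℕ => weightedFourierSum f n ((j : ℝ) / (j + 1)) x)
      Filter.atTop (nhds (weightedFourierSum f n 1 x)) := fun x => by
    have : Continuous fun r : ℝ => weightedFourierSum f n r x := by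
      unfold weightedFourierSum
      fun_prop
    exact (this.tendsto 1).comp hr
  have hmeas : ∀ j : ℕ, AEStronglyMeasurable (weightedFourierSum f n ((j : ℝ) / (j + 1)))
      periodMeasure := fun j => by
    have hc1 := continuous_cauchyTransform_circleMap (MemLp.integrable_periodMeasure hp hm1)
      (hr0 j) (hr1 j)
    have hc2 := continuous_cauchyTransform_circleMap (MemLp.integrable_periodMeasure hp hm2)
      (hr0 j) (hr1 j)
    have hc := continuous_circleMap 0 ((j : ℝ) / (j + 1))
    rw [funext (weightedFourierSum_eq_cauchyTransform hfi n (hr0 j) (hr1 j))]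
    exact Continuous.aestronglyMeasurable (by fun_prop)
  have hfatou := Lp.eLpNorm_lim_le_liminf_eLpNorm (p := ENNReal.ofReal p) hmeas
    (weightedFourierSum f n 1) (Filter.Eventually.of_forall hlim)
  calc eLpNorm (partialFourierSum f n) (ENNReal.ofReal p) periodMeasure
      ≤ eLpNorm (weightedFourierSum f n 1) (ENNReal.ofReal p) periodMeasure := by
        refine eLpNorm_mono fun x => ?_
        rw [weightedFourierSum_one hfi]
        have : 1 ≤ 2 * π := by linarith [Real.pi_gt_three]
        simp only [norm_mul, Complex.norm_real, Real.norm_eq_abs, Complex.norm_ofNat,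
          abs_of_pos Real.pi_pos]
        exact le_mul_of_one_le_left (abs_nonneg _) this
    _ ≤ _ := hfatou
    _ ≤ _ := Filter.liminf_le_of_le (by isBoundedDefault) fun b hb => by
        obtain ⟨j, hj⟩ := hb.exists
        exact hj.trans (hbound _ (hr0 j) (hr1 j))

theorem dirichletKernel_neg (n : ℕ) (u : ℝ) : dirichletKernel n (-u) = dirichletKernel n u := by
  simp [dirichletKernel]

theorem abs_dirichletKernel_le (n : ℕ) (u : ℝ) : |dirichletKernel n u| ≤ n + 1 := by
  rw [dirichletKernel]
  have h : |∑ k ∈ Finset.Icc 1 n, Real.cos (k * u)| ≤ n := by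
    refine (Finset.abs_sum_le_sum_abs _ _).trans
      ((Finset.sum_le_sum fun k _ => Real.abs_cos_le_one _).trans ?_)
    simp
  refine (abs_add_le _ _).trans ?_
  rw [abs_of_pos (by norm_num : (0 : ℝ) < 1 / 2)]
  linarith

theorem integral_partialFourierSum_mul {f h : ℝ → ℝ} (hf : Integrable f periodMeasure)
    (hh : Integrable h periodMeasure) (n : ℕ) :
    ∫ x, partialFourierSum f n x * h x ∂periodMeasure =
      ∫ t, f t * partialFourierSum h n t ∂periodMeasure := by
  have hint : Integrable (Function.uncurry fun x t =>
      h x * f t * dirichletKernel n (x - t)) (periodMeasure.prod periodMeasure) := by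
    refine (hh.mul_prod hf).mul_bdd (c := n + 1) (Continuous.aestronglyMeasurable ?_)
      (Filter.Eventually.of_forall fun z => abs_dirichletKernel_le n _)
    exact (continuous_dirichletKernel n).comp (by fun_prop)
  calc _ = (1 / π) * ∫ x, ∫ t, h x * f t * dirichletKernel n (x - t)
        ∂periodMeasure ∂periodMeasure := by
        rw [← integral_const_mul]
        refine integral_congr_ae (Filter.Eventually.of_forall fun x => ?_)
        simp only [partialFourierSum_eq, mul_assoc, integral_const_mul]
        ring
    _ = (1 / π) * ∫ t, ∫ x, h x * f t * dirichletKernel n (x - t)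
        ∂periodMeasure ∂periodMeasure := by rw [integral_integral_swap hint]
    _ = _ := by
        rw [← integral_const_mul]
        refine integral_congr_ae (Filter.Eventually.of_forall fun t => ?_)
        simp only [partialFourierSum_eq]
        rw [mul_left_comm, ← integral_const_mul (f t)]
        congr 1
        refine integral_congr_ae (Filter.Eventually.of_forall fun x => ?_)
        simp only
        rw [← dirichletKernel_neg n (x - t), neg_sub]
        ring

theorem exists_eLpNorm_partialFourierSum_le_of_two_lt {p : ℝ} (hp2 : 2 < p) :
    ∃ A : ℝ≥0, ∀ f : ℝ → ℝ, MemLp f (ENNReal.ofReal p) periodMeasure → ∀ n : ℕ,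
      eLpNorm (partialFourierSum f n) (ENNReal.ofReal p) periodMeasure ≤
        A * eLpNorm f (ENNReal.ofReal p) periodMeasure := by
  have hp : 1 < p := by linarith
  have hp0 : 0 < p := by linarith
  set q := p / (p - 1) with hq
  have hpq : p.HolderConjugate q := Real.HolderConjugate.conjExponent hp
  have hq1 : 1 < q := hpq.symm.lt
  have hq2 : q ≤ 2 := by
    rw [hq, div_le_iff₀ (by linarith)]
    linarith
  obtain ⟨A, hA⟩ := exists_eLpNorm_partialFourierSum_le_of_le_two hq1 hq2
  refine ⟨A, fun f hf n => ?_⟩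
  have hfi := MemLp.integrable_periodMeasure hp hf
  set g := partialFourierSum f n with hg
  have hgc : Continuous g := continuous_partialFourierSum hfi n
  set h : ℝ → ℝ := fun x => |g x| ^ (p - 2) * g x with hh
  have hhc : Continuous h := (hgc.abs.rpow_const fun _ => Or.inr (by linarith)).mul hgc
  have hgh : ∀ x, g x * h x = |g x| ^ p := fun x => by
    rcases eq_or_ne (g x) 0 with h0 | h0
    · simp [hh, h0, hp0.ne']
    · rw [hh]
      simp only
      rw [mul_left_comm, ← sq, ← sq_abs, ← Real.rpow_natCast, ← Real.rpow_add (abs_pos.2 h0)]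
      norm_num
  have hhe : ∀ x, ‖h x‖ₑ ^ q = ‖g x‖ₑ ^ p := fun x => by
    have h1 : ‖h x‖ = ‖g x‖ ^ (p - 1) := by
      rcases eq_or_ne (g x) 0 with h0 | h0
      · simp [hh, h0, (by linarith : p - 1 ≠ 0)]
      · simp only [hh, norm_mul, Real.norm_eq_abs, abs_of_nonneg (Real.rpow_nonneg (abs_nonneg _) _)]
        conv_lhs => enter [2]; rw [← Real.rpow_one |g x|]
        rw [← Real.rpow_add (abs_pos.2 h0)]
        ring_nf
    rw [← ofReal_norm, h1, ← ofReal_norm, ← ENNReal.ofReal_rpow_of_nonneg (norm_nonneg _)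
      (by linarith), ← ENNReal.rpow_mul, hq, mul_div_cancel₀ _ (by linarith)]
  have hmem : MemLp h (ENNReal.ofReal q) periodMeasure := by
    obtain ⟨M, hM⟩ := (isCompact_Icc (a := (0 : ℝ)) (b := 2 * π)).exists_bound_of_continuousOn
      hhc.continuousOn
    refine MemLp.of_bound hhc.aestronglyMeasurable M ?_
    filter_upwards [ae_restrict_mem measurableSet_Ioc] with t ht
    exact hM t (Set.Ioc_subset_Icc_self ht)
  have hgi : Integrable (fun x => |g x| ^ p) periodMeasure :=
    (hgc.abs.rpow_const fun _ => Or.inr hp0.le).integrable_periodMeasure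
  set I := ∫⁻ x, ‖g x‖ₑ ^ p ∂periodMeasure with hI
  have hIeq : I = ENNReal.ofReal (∫ x, |g x| ^ p ∂periodMeasure) := by
    rw [ofReal_integral_eq_lintegral_ofReal hgi
      (Filter.Eventually.of_forall fun x => by positivity), hI]
    refine lintegral_congr fun x => ?_
    rw [← ofReal_norm, ENNReal.ofReal_rpow_of_nonneg (norm_nonneg _) hp0.le, Real.norm_eq_abs]
  have hItop : I ≠ ∞ := hIeq ▸ ENNReal.ofReal_ne_top
  have hkey : I ≤ (A * eLpNorm f (ENNReal.ofReal p) periodMeasure) * I ^ (1 / q) := by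
    calc I = ENNReal.ofReal (∫ t, f t * partialFourierSum h n t ∂periodMeasure) := by
          rw [hIeq, ← integral_partialFourierSum_mul hfi hhc.integrable_periodMeasure]
          simp only [← hg, hgh]
      _ ≤ ‖∫ t, f t * partialFourierSum h n t ∂periodMeasure‖ₑ := by
          rw [← ofReal_norm]
          exact ENNReal.ofReal_le_ofReal (le_abs_self _)
      _ ≤ ∫⁻ t, ‖f t‖ₑ * ‖partialFourierSum h n t‖ₑ ∂periodMeasure := by
          refine (enorm_integral_le_lintegral_enorm _).trans_eq ?_
          simp only [enorm_mul]
      _ ≤ eLpNorm f (ENNReal.ofReal p) periodMeasure *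
          eLpNorm (partialFourierSum h n) (ENNReal.ofReal q) periodMeasure := by
          rw [eLpNorm_ofReal_eq_lintegral hp0, eLpNorm_ofReal_eq_lintegral hpq.symm.pos]
          exact ENNReal.lintegral_mul_le_Lp_mul_Lq _ hpq hfi.aestronglyMeasurable.enorm
            (continuous_partialFourierSum hhc.integrable_periodMeasure
              n).aestronglyMeasurable.enorm
      _ ≤ eLpNorm f (ENNReal.ofReal p) periodMeasure * (A * I ^ (1 / q)) := by
          gcongr
          refine (hA h hmem n).trans_eq ?_
          rw [eLpNorm_ofReal_eq_lintegral hpq.symm.pos, hI]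
          simp only [hhe]
      _ = _ := by ring
  rw [eLpNorm_ofReal_eq_lintegral hp0 g, ← hI]
  rcases eq_or_ne I 0 with h0 | h0
  · rw [h0, ENNReal.zero_rpow_of_pos (by positivity)]
    exact zero_le
  · have hsum : 1 / p + 1 / q = 1 := by simpa using hpq.inv_add_inv_eq_one
    have hsplit : I ^ (1 / p) * I ^ (1 / q) = I := by
      rw [← ENNReal.rpow_add _ _ h0 hItop, hsum, ENNReal.rpow_one]
    have hne : I ^ (1 / q) ≠ 0 := by
      simp [ENNReal.rpow_eq_zero_iff, h0, hItop]
    have hnt : I ^ (1 / q) ≠ ∞ :=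
      ENNReal.rpow_ne_top_of_nonneg (by have := hpq.symm.pos; positivity) hItop
    rw [← ENNReal.mul_le_mul_iff_left hne hnt, hsplit]
    exact hkey

/-- **M. Riesz's theorem**: partial Fourier sums are uniformly bounded on `L^p`, `1 < p < ∞`. -/
theorem exists_eLpNorm_partialFourierSum_le {p : ℝ} (hp : 1 < p) :
    ∃ A : ℝ≥0, ∀ f : ℝ → ℝ, MemLp f (ENNReal.ofReal p) periodMeasure → ∀ n : ℕ,
      eLpNorm (partialFourierSum f n) (ENNReal.ofReal p) periodMeasure ≤
        A * eLpNorm f (ENNReal.ofReal p) periodMeasure := by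
  rcases le_or_gt p 2 with h | h
  · exact exists_eLpNorm_partialFourierSum_le_of_le_two hp h
  · exact exists_eLpNorm_partialFourierSum_le_of_two_lt h

theorem integral_cos_sub_int_mul (c : ℝ) (N : ℤ) :
    ∫ t, Real.cos (c - N * t) ∂periodMeasure = if N = 0 then 2 * π * Real.cos c else 0 := by
  rw [← intervalIntegral.integral_of_le (by positivity)]
  split_ifs with hN
  · simp [hN]
  · have hN' : (N : ℝ) ≠ 0 := by exact_mod_cast hN
    rw [intervalIntegral.integral_comp_sub_mul Real.cos hN', integral_cos]
    rw [mul_zero, sub_zero, Real.sin_sub_int_mul_two_pi, sub_self, smul_zero]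

theorem integral_cos_mul_cos (m a : ℕ) (ha : 1 ≤ a) (s x : ℝ) :
    ∫ t, Real.cos (m * (s - t)) * Real.cos (a * (x - t)) ∂periodMeasure =
      if a = m then π * Real.cos (m * (x - s)) else 0 := by
  have hprod : ∀ t : ℝ, Real.cos (m * (s - t)) * Real.cos (a * (x - t)) =
      (1 / 2) * Real.cos ((m * s - a * x) - ((m - a : ℤ) : ℝ) * t) +
      (1 / 2) * Real.cos ((m * s + a * x) - ((m + a : ℤ) : ℝ) * t) := fun t => by
    have h1 : (m * s - a * x) - ((m - a : ℤ) : ℝ) * t = m * (s - t) - a * (x - t) := by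
      push_cast; ring
    have h2 : (m * s + a * x) - ((m + a : ℤ) : ℝ) * t = m * (s - t) + a * (x - t) := by
      push_cast; ring
    rw [h1, h2, Real.cos_sub, Real.cos_add]
    ring
  simp_rw [hprod]
  rw [integral_add, integral_const_mul, integral_const_mul, integral_cos_sub_int_mul,
    integral_cos_sub_int_mul, if_neg (by omega : ¬ ((m : ℤ) + a = 0))]
  · by_cases h : a = m
    · rw [if_pos (by omega), if_pos h, h, ← mul_sub, ← neg_sub x s, mul_neg, Real.cos_neg]
      ring
    · rw [if_neg (by omega), if_neg h]
      ring
  · exact Continuous.integrable_periodMeasure (by fun_prop)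
  · exact Continuous.integrable_periodMeasure (by fun_prop)

theorem integral_cos_mul_dirichletKernel {m n : ℕ} (hmn : m ≤ n) (s x : ℝ) :
    ∫ t, Real.cos (m * (s - t)) * dirichletKernel n (x - t) ∂periodMeasure =
      π * Real.cos (m * (x - s)) := by
  simp only [dirichletKernel, mul_add, Finset.mul_sum]
  rw [integral_add, integral_finsetSum]
  · rw [Finset.sum_congr rfl fun a ha => integral_cos_mul_cos m a (Finset.mem_Icc.1 ha).1 s x]
    rw [Finset.sum_ite_eq', integral_mul_const]
    have h := integral_cos_sub_int_mul (m * s) m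
    simp only [Int.cast_natCast, ← mul_sub] at h
    rw [h]
    rcases Nat.eq_zero_or_pos m with rfl | hm
    · simp; ring
    · rw [if_neg (by omega), if_pos (Finset.mem_Icc.2 ⟨hm, hmn⟩)]
      ring
  · exact fun k _ => Continuous.integrable_periodMeasure (by fun_prop)
  · exact Continuous.integrable_periodMeasure (by fun_prop)
  · exact Continuous.integrable_periodMeasure (by fun_prop)

theorem integral_dirichletKernel_mul_dirichletKernel {k n : ℕ} (hkn : k ≤ n) (s x : ℝ) :
    ∫ t, dirichletKernel n (x - t) * dirichletKernel k (s - t) ∂periodMeasure =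
      π * dirichletKernel k (x - s) := by
  have hc := continuous_dirichletKernel n
  have h0 := integral_cos_mul_dirichletKernel (Nat.zero_le n) s x
  simp only [Nat.cast_zero, zero_mul, Real.cos_zero, one_mul, mul_one] at h0
  have hexp : ∀ t, dirichletKernel n (x - t) * dirichletKernel k (s - t) =
      (1 / 2) * dirichletKernel n (x - t) +
        ∑ m ∈ Finset.Icc 1 k, Real.cos (m * (s - t)) * dirichletKernel n (x - t) := fun t => by
    rw [mul_comm, dirichletKernel.eq_1 k, add_mul, Finset.sum_mul]
  simp_rw [hexp]
  rw [integral_add, integral_finsetSum, integral_const_mul, h0, dirichletKernel.eq_1 k, mul_add,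
    Finset.mul_sum]
  · congr 1
    · ring
    · exact Finset.sum_congr rfl fun m hm =>
        integral_cos_mul_dirichletKernel ((Finset.mem_Icc.1 hm).2.trans hkn) s x
  · exact fun k _ => Continuous.integrable_periodMeasure (by fun_prop)
  · exact Continuous.integrable_periodMeasure (by fun_prop)
  · exact Continuous.integrable_periodMeasure (by fun_prop)

theorem partialFourierSum_partialFourierSum {f : ℝ → ℝ} (hf : Integrable f periodMeasure)
    {k n : ℕ} (hkn : k ≤ n) (x : ℝ) :
    partialFourierSum (partialFourierSum f k) n x = partialFourierSum f k x := by
  have hc := continuous_dirichletKernel n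
  have hpi := Real.pi_ne_zero
  rw [partialFourierSum_eq, integral_partialFourierSum_mul hf
    (Continuous.integrable_periodMeasure (by fun_prop)), partialFourierSum_eq]
  congr 1
  refine integral_congr_ae (Filter.Eventually.of_forall fun t => ?_)
  simp only
  rw [partialFourierSum_eq, integral_dirichletKernel_mul_dirichletKernel hkn]
  field_simp

/-- The Fejér kernel, the arithmetic mean of the Dirichlet kernels. -/
noncomputable def fejerKernel (n : ℕ) (u : ℝ) : ℝ :=
  (1 / ((n : ℝ) + 1)) * ∑ k ∈ Finset.range (n + 1), dirichletKernel k u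

theorem continuous_fejerKernel (n : ℕ) : Continuous (fejerKernel n) := by
  have := continuous_dirichletKernel
  unfold fejerKernel
  fun_prop

theorem dirichletKernel_add_two_pi (n : ℕ) (u : ℝ) :
    dirichletKernel n (u + 2 * π) = dirichletKernel n u := by
  simp only [dirichletKernel, mul_add, Real.cos_add_nat_mul_two_pi]

theorem fejerKernel_periodic (n : ℕ) : Function.Periodic (fejerKernel n) (2 * π) := fun u => by
  simp only [fejerKernel, dirichletKernel_add_two_pi]

theorem fejerKernel_neg (n : ℕ) (u : ℝ) : fejerKernel n (-u) = fejerKernel n u := by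
  simp only [fejerKernel, dirichletKernel_neg]

theorem dirichletKernel_succ (n : ℕ) (u : ℝ) :
    dirichletKernel (n + 1) u = dirichletKernel n u + Real.cos ((n + 1 : ℕ) * u) := by
  rw [dirichletKernel, dirichletKernel, Finset.sum_Icc_succ_top (by omega), add_assoc]

theorem two_mul_one_sub_cos_mul_dirichletKernel (n : ℕ) (u : ℝ) :
    2 * (1 - Real.cos u) * dirichletKernel n u =
      Real.cos (n * u) - Real.cos ((n + 1 : ℕ) * u) := by
  induction n with
  | zero =>
    simp only [dirichletKernel, zero_add, Nat.cast_zero, Nat.cast_one, zero_mul, one_mul,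
      Real.cos_zero, Finset.Icc_eq_empty_of_lt one_pos, Finset.sum_empty]
    ring
  | succ n ih =>
    rw [dirichletKernel_succ, mul_add, ih]
    have h1 : ((n + 1 + 1 : ℕ) : ℝ) * u = (n + 1 : ℕ) * u + u := by push_cast; ring
    have h2 : (n : ℝ) * u = (n + 1 : ℕ) * u - u := by push_cast; ring
    rw [h1, h2, Real.cos_add, Real.cos_sub]
    ring

theorem abs_fejerKernel_le (n : ℕ) (u : ℝ) : |fejerKernel n u| ≤ n + 1 := by
  have hn : (0 : ℝ) < n + 1 := by positivity
  rw [fejerKernel, abs_mul, abs_of_pos (by positivity), one_div, inv_mul_le_iff₀ hn]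
  refine (Finset.abs_sum_le_sum_abs _ _).trans ?_
  refine (Finset.sum_le_card_nsmul _ _ ((n : ℝ) + 1) fun k hk => ?_).trans ?_
  · refine (abs_dirichletKernel_le k u).trans ?_
    have : (k : ℝ) ≤ n := by exact_mod_cast Nat.lt_succ_iff.1 (Finset.mem_range.1 hk)
    linarith
  · rw [Finset.card_range, nsmul_eq_mul]
    push_cast
    exact le_rfl

theorem abs_fejerKernel_mul_one_sub_cos_le (n : ℕ) (u : ℝ) :
    |fejerKernel n u| * (1 - Real.cos u) ≤ 1 / ((n : ℝ) + 1) := by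
  have hn : (0 : ℝ) < n + 1 := by positivity
  have hc : 0 ≤ 1 - Real.cos u := by linarith [Real.cos_le_one u]
  have hsum : (∑ k ∈ Finset.range (n + 1), dirichletKernel k u) * (1 - Real.cos u) =
      (1 - Real.cos ((n + 1 : ℕ) * u)) / 2 := by
    have h := Finset.sum_range_sub' (fun k : ℕ => Real.cos (k * u)) (n + 1)
    simp only [← two_mul_one_sub_cos_mul_dirichletKernel, ← Finset.mul_sum] at h
    simp only [Nat.cast_zero, zero_mul, Real.cos_zero] at h
    linarith
  rw [← abs_of_nonneg hc, ← abs_mul, fejerKernel, mul_assoc, hsum, abs_mul,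
    abs_of_pos (by positivity : 0 < 1 / ((n : ℝ) + 1))]
  refine mul_le_of_le_one_right (by positivity) (abs_le.2 ?_)
  constructor <;> linarith [Real.cos_le_one ((n + 1 : ℕ) * u), Real.neg_one_le_cos ((n + 1 : ℕ) * u)]

theorem abs_fejerKernel_le_div_sq (n : ℕ) {u : ℝ} (hu0 : u ≠ 0) (hu : |u| ≤ π) :
    |fejerKernel n u| ≤ π ^ 2 / (2 * ((n : ℝ) + 1)) * (|u| ^ 2)⁻¹ := by
  have hpi := Real.pi_pos
  have hn : (0 : ℝ) < n + 1 := by positivity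
  have hc : 2 / π ^ 2 * u ^ 2 ≤ 1 - Real.cos u := by
    have := Real.cos_le_one_sub_mul_cos_sq hu
    linarith
  have hu2 : 0 < u ^ 2 := by positivity
  have h := (mul_le_mul_of_nonneg_left hc (abs_nonneg (fejerKernel n u))).trans
    (abs_fejerKernel_mul_one_sub_cos_le n u)
  rw [sq_abs]
  have h2 : |fejerKernel n u| * (2 / π ^ 2 * u ^ 2) * (π ^ 2 / 2 * (u ^ 2)⁻¹) =
      |fejerKernel n u| := by field_simp
  rw [← h2]
  refine (mul_le_mul_of_nonneg_right h (by positivity)).trans_eq ?_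
  field_simp

theorem lintegral_fejerKernel_mul_rpow_le {α : ℝ} (hα0 : 0 < α) (hα1 : α < 1) :
    ∃ C : ℝ, 0 ≤ C ∧ ∀ n : ℕ, ∫⁻ t in Set.Ioc (-π) π,
      ENNReal.ofReal (|fejerKernel n t| * |t| ^ α) ≤
        ENNReal.ofReal (C * ((n : ℝ) + 1) ^ (-α)) := by
  have h1α : 0 < 1 - α := by linarith
  have hpi := Real.pi_pos
  refine ⟨2 + π ^ 2 / (1 - α), by positivity, fun n => ?_⟩
  set N : ℝ := (n : ℝ) + 1 with hN
  have hN0 : 0 < N := by positivity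
  have hNi : 0 < N⁻¹ := by positivity
  have hNα : N ^ (-α) = N⁻¹ ^ α := by rw [Real.inv_rpow hN0.le, Real.rpow_neg hN0.le]
  set g : ℝ → ℝ≥0∞ := fun t => ENNReal.ofReal (|fejerKernel n t| * |t| ^ α) with hg
  have hnear : ∫⁻ t in Set.Icc (-N⁻¹) N⁻¹, g t ≤ ENNReal.ofReal (2 * N ^ (-α)) := by
    refine (setLIntegral_mono' measurableSet_Icc fun t ht =>
      ENNReal.ofReal_le_ofReal (mul_le_mul (abs_fejerKernel_le n t)
        (Real.rpow_le_rpow (abs_nonneg t) (abs_le.2 ht) hα0.le) (by positivity)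
        (by positivity))).trans_eq ?_
    rw [setLIntegral_const, Real.volume_Icc, ← ENNReal.ofReal_mul (by positivity), hNα, ← hN]
    congr 1
    field_simp
    ring
  have hfar : ∫⁻ t in Set.Ioc N⁻¹ π, g t ≤
      ENNReal.ofReal (π ^ 2 / 2 / (1 - α) * N ^ (-α)) := by
    have hint : IntegrableOn (fun t : ℝ => t ^ (α - 2)) (Set.Ioi N⁻¹) :=
      integrableOn_Ioi_rpow_of_lt (by linarith) hNi
    calc ∫⁻ t in Set.Ioc N⁻¹ π, g t
        ≤ ∫⁻ t in Set.Ioc N⁻¹ π, ENNReal.ofReal (π ^ 2 / (2 * N) * t ^ (α - 2)) := by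
          refine setLIntegral_mono' measurableSet_Ioc fun t ht => ENNReal.ofReal_le_ofReal ?_
          have ht0 : 0 < t := hNi.trans ht.1
          have h := abs_fejerKernel_le_div_sq n ht0.ne' (by rw [abs_of_pos ht0]; exact ht.2)
          rw [abs_of_pos ht0] at h ⊢
          refine (mul_le_mul_of_nonneg_right h (by positivity)).trans_eq ?_
          rw [Real.rpow_sub ht0, Real.rpow_two, mul_assoc, div_eq_inv_mul (t ^ α)]
      _ ≤ ∫⁻ t in Set.Ioi N⁻¹, ENNReal.ofReal (π ^ 2 / (2 * N) * t ^ (α - 2)) :=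
          lintegral_mono_set Set.Ioc_subset_Ioi_self
      _ = ENNReal.ofReal (∫ t in Set.Ioi N⁻¹, π ^ 2 / (2 * N) * t ^ (α - 2)) := by
          rw [ofReal_integral_eq_lintegral_ofReal (hint.const_mul _)]
          refine (ae_restrict_iff' measurableSet_Ioi).2 (Filter.Eventually.of_forall fun t ht => ?_)
          have ht0 : 0 < t := hNi.trans ht
          positivity
      _ = _ := by
          rw [integral_const_mul, integral_Ioi_rpow_of_lt (by linarith) hNi, hNα]
          congr 1
          have : α - 2 + 1 = -(1 - α) := by ring
          rw [this, neg_div_neg_eq, neg_sub, Real.rpow_sub hNi, Real.rpow_one]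
          field_simp
  have hfar' : ∫⁻ t in Set.Ico (-π) (-N⁻¹), g t ≤
      ENNReal.ofReal (π ^ 2 / 2 / (1 - α) * N ^ (-α)) := by
    refine le_trans (le_of_eq ?_) hfar
    rw [← lintegral_indicator measurableSet_Ico, ← lintegral_indicator measurableSet_Ioc,
      ← lintegral_neg_eq_self]
    refine lintegral_congr fun t => ?_
    have hiff : -t ∈ Set.Ico (-π) (-N⁻¹) ↔ t ∈ Set.Ioc N⁻¹ π := by
      simp only [Set.mem_Ico, Set.mem_Ioc, neg_le_neg_iff, neg_lt_neg_iff, and_comm]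
    by_cases ht : t ∈ Set.Ioc N⁻¹ π
    · rw [Set.indicator_of_mem ht, Set.indicator_of_mem (hiff.2 ht)]
      simp only [hg, fejerKernel_neg, abs_neg]
    · rw [Set.indicator_of_notMem ht, Set.indicator_of_notMem (mt hiff.1 ht)]
  have hsub : Set.Ioc (-π) π ⊆ (Set.Icc (-N⁻¹) N⁻¹ ∪ Set.Ioc N⁻¹ π) ∪ Set.Ico (-π) (-N⁻¹) := by
    intro t ht
    rcases lt_or_ge t (-N⁻¹) with h | h
    · exact Or.inr ⟨ht.1.le, h⟩
    · rcases le_or_gt t N⁻¹ with h' | h'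
      · exact Or.inl (Or.inl ⟨h, h'⟩)
      · exact Or.inl (Or.inr ⟨h', ht.2⟩)
  refine (lintegral_mono_set hsub).trans ((lintegral_union_le _ _ _).trans
    ((add_le_add ((lintegral_union_le _ _ _).trans (add_le_add hnear hfar)) hfar').trans_eq ?_))
  rw [← ENNReal.ofReal_add (by positivity) (by positivity),
    ← ENNReal.ofReal_add (by positivity) (by positivity)]
  congr 1
  ring

theorem Function.Periodic.lintegral_periodMeasure_add {g : ℝ → ℝ≥0∞}
    (hg : Function.Periodic g (2 * π)) (h : ℝ) :
    ∫⁻ x, g (x + h) ∂periodMeasure = ∫⁻ x, g x ∂periodMeasure := by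
  have hpi : 0 < 2 * π := by positivity
  have h1 : ∫⁻ x, g (x + h) ∂periodMeasure = ∫⁻ x in Set.Ioc h (h + 2 * π), g x := by
    have := (measurePreserving_add_right volume h).setLIntegral_comp_emb
      (measurableEmbedding_addRight h) g (Set.Ioc 0 (2 * π))
    rw [this]
    simp [add_comm]
  rw [h1, periodMeasure]
  have h2 := (isAddFundamentalDomain_Ioc hpi h).setLIntegral_eq
    (isAddFundamentalDomain_Ioc hpi 0) g fun a x => by
      obtain ⟨m, hm⟩ := AddSubgroup.mem_zmultiples_iff.1 a.2
      change g ((a : ℝ) + x) = g x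
      rw [← hm, add_comm]
      exact hg.zsmul m x
  rwa [zero_add] at h2

theorem aestronglyMeasurable_of_intervalIntegrable {f : ℝ → ℝ}
    (hf : ∀ a b : ℝ, IntervalIntegrable f volume a b) : AEStronglyMeasurable f volume := by
  have hU : (⋃ n : ℕ, Set.Ioc (-(n : ℝ)) n) = Set.univ := by
    refine Set.eq_univ_of_forall fun x => Set.mem_iUnion.2 ?_
    obtain ⟨n, hn⟩ := exists_nat_gt |x|
    exact ⟨n, (abs_lt.1 hn).1, (abs_lt.1 hn).2.le⟩
  rw [← Measure.restrict_univ (μ := volume), ← hU, aestronglyMeasurable_iUnion_iff]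
  exact fun n => (hf (-n) n).1.aestronglyMeasurable

theorem lpNorm_eq_toReal_eLpNorm {p : ℝ} (hp : 0 < p) {g : ℝ → ℝ}
    (hg : AEStronglyMeasurable g periodMeasure) :
    _root_.lpNorm p g =
      (1 / (2 * π)) ^ (1 / p) * (eLpNorm g (ENNReal.ofReal p) periodMeasure).toReal := by
  have hm : AEStronglyMeasurable (fun x => |g x| ^ p) periodMeasure :=
    (hg.norm.aemeasurable.pow_const p).aestronglyMeasurable
  rw [_root_.lpNorm, intervalIntegral.integral_of_le (by positivity),
    integral_eq_lintegral_of_nonneg_ae (Filter.Eventually.of_forall fun x => by positivity) hm,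
    Real.mul_rpow (by positivity) ENNReal.toReal_nonneg, eLpNorm_ofReal_eq_lintegral hp,
    ENNReal.toReal_rpow]
  congr 4
  funext x
  rw [← ENNReal.ofReal_rpow_of_nonneg (abs_nonneg _) hp.le, Real.enorm_eq_ofReal_abs]

section LipClass

variable {α p : ℝ} {f : ℝ → ℝ}

theorem LipClass.intervalIntegrable (hf : LipClass α p f) (a b : ℝ) :
    IntervalIntegrable f volume a b :=
  hf.1.intervalIntegrable₀ (by positivity) hf.2.1 a b

theorem LipClass.aestronglyMeasurable (hf : LipClass α p f) : AEStronglyMeasurable f volume :=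
  aestronglyMeasurable_of_intervalIntegrable hf.intervalIntegrable

theorem LipClass.memLp (hp : 1 < p) (hf : LipClass α p f) :
    MemLp f (ENNReal.ofReal p) periodMeasure := by
  have hp0 : 0 < p := by linarith
  rw [← integrable_norm_rpow_iff hf.aestronglyMeasurable.restrict (by simpa using hp0)
    ENNReal.ofReal_ne_top, ENNReal.toReal_ofReal hp0.le]
  exact (intervalIntegrable_iff_integrableOn_Ioc_of_le (by positivity)).1 hf.2.2.1

theorem LipClass.aestronglyMeasurable_comp_add (hf : LipClass α p f) (h : ℝ) :
    AEStronglyMeasurable (fun x => f (x + h)) periodMeasure :=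
  (hf.aestronglyMeasurable.comp_quasiMeasurePreserving
    (measurePreserving_add_right volume h).quasiMeasurePreserving).restrict

theorem LipClass.eLpNorm_comp_add (hp : 1 < p) (hf : LipClass α p f) (h : ℝ) :
    eLpNorm (fun x => f (x + h)) (ENNReal.ofReal p) periodMeasure =
      eLpNorm f (ENNReal.ofReal p) periodMeasure := by
  have hp0 : 0 < p := by linarith
  rw [eLpNorm_ofReal_eq_lintegral hp0, eLpNorm_ofReal_eq_lintegral hp0,
    Function.Periodic.lintegral_periodMeasure_add (g := fun x => ‖f x‖ₑ ^ p)
      (fun x => by simp only [hf.1 x])]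

theorem LipClass.memLp_comp_add (hp : 1 < p) (hf : LipClass α p f) (h : ℝ) :
    MemLp (fun x => f (x + h)) (ENNReal.ofReal p) periodMeasure :=
  ⟨hf.aestronglyMeasurable_comp_add h, by
    rw [hf.eLpNorm_comp_add hp]; exact (hf.memLp hp).2⟩

theorem LipClass.exists_eLpNorm_comp_add_sub_le (hp : 1 < p) (hf : LipClass α p f) :
    ∃ C : ℝ, 0 ≤ C ∧ ∀ h : ℝ, h ≠ 0 →
      eLpNorm (fun x => f (x + h) - f x) (ENNReal.ofReal p) periodMeasure ≤
        ENNReal.ofReal (C * |h| ^ α) := by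
  have hp0 : 0 < p := by linarith
  have hp1 : 1 ≤ ENNReal.ofReal p := by simpa using hp.le
  obtain ⟨C, hC0, hC⟩ := hf.2.2.2
  have hc : 0 < (1 / (2 * π)) ^ (1 / p) := by positivity
  have hval : ∀ h : ℝ, ((1 / (2 * π)) * ∫ x in (0 : ℝ)..(2 * π), |f (x + h) - f x| ^ p) ^ (1 / p) =
      (1 / (2 * π)) ^ (1 / p) *
        (eLpNorm (fun x => f (x + h) - f x) (ENNReal.ofReal p) periodMeasure).toReal := fun h =>
    lpNorm_eq_toReal_eLpNorm hp0 ((hf.memLp_comp_add hp h).sub (hf.memLp hp)).1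
  refine ⟨C / (1 / (2 * π)) ^ (1 / p), by positivity, fun h hh => ?_⟩
  have hbdd : BddAbove {y : ℝ | ∃ h' : ℝ, 0 < |h'| ∧ |h'| ≤ |h| ∧
      y = ((1 / (2 * π)) * ∫ x in (0 : ℝ)..(2 * π), |f (x + h') - f x| ^ p) ^ (1 / p)} := by
    refine ⟨(1 / (2 * π)) ^ (1 / p) * (eLpNorm f (ENNReal.ofReal p) periodMeasure +
      eLpNorm f (ENNReal.ofReal p) periodMeasure).toReal, ?_⟩
    rintro y ⟨h', -, -, rfl⟩
    rw [hval]
    refine mul_le_mul_of_nonneg_left (ENNReal.toReal_mono ?_ ?_) hc.le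
    · exact (ENNReal.add_lt_top.2 ⟨(hf.memLp hp).2, (hf.memLp hp).2⟩).ne
    · refine (eLpNorm_sub_le (hf.memLp_comp_add hp h').1 (hf.memLp hp).1 hp1).trans_eq ?_
      rw [hf.eLpNorm_comp_add hp]
  have h1 := (le_csSup hbdd ⟨h, abs_pos.2 hh, le_rfl, (hval h).symm⟩).trans (hC |h| (abs_pos.2 hh))
  have hfin : eLpNorm (fun x => f (x + h) - f x) (ENNReal.ofReal p) periodMeasure ≠ ∞ :=
    ((hf.memLp_comp_add hp h).sub (hf.memLp hp)).2.ne
  rw [← ENNReal.ofReal_toReal hfin]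
  refine ENNReal.ofReal_le_ofReal ?_
  rw [div_mul_eq_mul_div, le_div_iff₀ hc, mul_comm]
  exact h1

end LipClass

/-- The Fejér means of the Fourier series of `f`. -/
noncomputable def fejerMean (f : ℝ → ℝ) (n : ℕ) (x : ℝ) : ℝ :=
  (1 / ((n : ℝ) + 1)) * ∑ k ∈ Finset.range (n + 1), partialFourierSum f k x

theorem continuous_fejerMean {f : ℝ → ℝ} (hf : Integrable f periodMeasure) (n : ℕ) :
    Continuous (fejerMean f n) :=
  continuous_const.mul (continuous_finsetSum _ fun k _ => continuous_partialFourierSum hf k)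

theorem integrable_mul_dirichletKernel {f : ℝ → ℝ} (hf : Integrable f periodMeasure) (k : ℕ)
    (x : ℝ) : Integrable (fun t => f t * dirichletKernel k (x - t)) periodMeasure :=
  hf.mul_bdd (c := k + 1)
    ((continuous_dirichletKernel k).comp (by fun_prop)).aestronglyMeasurable
    (Filter.Eventually.of_forall fun _ => abs_dirichletKernel_le k _)

theorem fejerMean_eq {f : ℝ → ℝ} (hf : Integrable f periodMeasure)
    (hper : Function.Periodic f (2 * π)) (n : ℕ) (x : ℝ) :
    fejerMean f n x = (1 / π) * ∫ t in (-π)..π, f (x - t) * fejerKernel n t := by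
  have h1 : fejerMean f n x =
      (1 / π) * ∫ t in (0 : ℝ)..(2 * π), f t * fejerKernel n (x - t) := by
    simp only [fejerMean, partialFourierSum_eq, fejerKernel, ← Finset.mul_sum]
    rw [← integral_finsetSum _ fun k _ => integrable_mul_dirichletKernel hf k x,
      intervalIntegral.integral_of_le (by positivity), mul_left_comm, ← integral_const_mul]
    congr 1
    refine integral_congr_ae (Filter.Eventually.of_forall fun t => ?_)
    simp only [← Finset.mul_sum]
    ring
  have hg : Function.Periodic (fun t => f (x - t) * fejerKernel n t) (2 * π) := fun t => by
    simp only [fejerKernel_periodic n t, ← sub_sub, hper.sub_eq]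
  have h2 := intervalIntegral.integral_comp_sub_left (a := 0) (b := 2 * π)
    (fun t => f (x - t) * fejerKernel n t) x
  have h3 := hg.intervalIntegral_add_eq (x - 2 * π) (-π)
  simp only [sub_sub_cancel, sub_zero] at h2
  rw [h1, h2]
  rw [sub_add_cancel, show -π + 2 * π = π by ring] at h3
  rw [h3]

theorem integral_fejerKernel (n : ℕ) : ∫ t in (-π)..π, fejerKernel n t = π := by
  have hpi := Real.pi_ne_zero
  have hn : (n : ℝ) + 1 ≠ 0 := by positivity
  have h := fejerMean_eq (f := fun _ => 1) (integrable_const _) (fun _ => rfl) n 0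
  have hS : ∀ k, partialFourierSum (fun _ => 1) k 0 = 1 := fun k => by
    rw [partialFourierSum_eq]
    have h0 := integral_cos_mul_dirichletKernel (Nat.zero_le k) 0 0
    simp only [Nat.cast_zero, zero_mul, Real.cos_zero, mul_one] at h0
    rw [h0, one_div, inv_mul_cancel₀ hpi]
  simp only [fejerMean, hS, one_mul, Finset.sum_const, Finset.card_range, nsmul_eq_mul] at h
  push_cast at h
  field_simp at h
  exact h.symm

section LipClass

variable {α p : ℝ} {f : ℝ → ℝ}

theorem LipClass.integrable (hf : LipClass α p f) : Integrable f periodMeasure :=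
  (intervalIntegrable_iff_integrableOn_Ioc_of_le (by positivity)).1 hf.2.1

theorem LipClass.fejerMean_sub_eq (hf : LipClass α p f) (n : ℕ) (x : ℝ) :
    fejerMean f n x - f x =
      (1 / π) * ∫ t in Set.Ioc (-π) π, fejerKernel n t * (f (x - t) - f x) := by
  have hpi := Real.pi_pos
  have hc : 1 / π * (f x * π) = f x := by field_simp
  have hi : IntervalIntegrable (fun t => f (x - t) * fejerKernel n t) volume (-π) π := by
    have h := (hf.intervalIntegrable (x - -π) (x - π)).comp_sub_left x
    rw [sub_sub_cancel, sub_sub_cancel] at h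
    exact h.mul_continuousOn (continuous_fejerKernel n).continuousOn
  have hj : IntervalIntegrable (fun t => f x * fejerKernel n t) volume (-π) π :=
    ((continuous_fejerKernel n).const_mul _).intervalIntegrable _ _
  have hsub : ∫ t in (-π)..π, fejerKernel n t * (f (x - t) - f x) =
      (∫ t in (-π)..π, f (x - t) * fejerKernel n t) - f x * π := by
    have hconst : f x * π = ∫ t in (-π)..π, f x * fejerKernel n t := by
      rw [intervalIntegral.integral_const_mul, integral_fejerKernel]
    rw [hconst, ← intervalIntegral.integral_sub hi hj]
    exact intervalIntegral.integral_congr fun t _ => by ring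
  rw [fejerMean_eq hf.integrable hf.1, ← intervalIntegral.integral_of_le (by linarith), hsub,
    mul_sub, hc]

theorem LipClass.aemeasurable_uncurry_sub (hf : LipClass α p f) :
    AEMeasurable (Function.uncurry fun x t : ℝ => ‖f (x - t) - f x‖ₑ)
      (periodMeasure.prod (volume.restrict (Set.Ioc (-π) π))) := by
  have h1 : AEStronglyMeasurable (fun z : ℝ × ℝ => f (z.1 - z.2) - f z.1)
      ((volume : Measure ℝ).prod (volume : Measure ℝ)) :=
    (hf.aestronglyMeasurable.comp_quasiMeasurePreserving
      (quasiMeasurePreserving_sub volume volume)).sub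
      (hf.aestronglyMeasurable.comp_quasiMeasurePreserving Measure.quasiMeasurePreserving_fst)
  rw [periodMeasure, Measure.prod_restrict]
  exact h1.enorm.restrict

theorem LipClass.exists_eLpNorm_fejerMean_sub_le (hp : 1 < p) (hα0 : 0 < α) (hα1 : α < 1)
    (hf : LipClass α p f) :
    ∃ C : ℝ, 0 ≤ C ∧ ∀ n : ℕ,
      eLpNorm (fun x => fejerMean f n x - f x) (ENNReal.ofReal p) periodMeasure ≤
        ENNReal.ofReal (C * ((n : ℝ) + 1) ^ (-α)) := by
  have hp0 : 0 < p := by linarith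
  have hpi := Real.pi_pos
  obtain ⟨C₁, hC₁0, hC₁⟩ := hf.exists_eLpNorm_comp_add_sub_le hp
  obtain ⟨C₂, hC₂0, hC₂⟩ := lintegral_fejerKernel_mul_rpow_le hα0 hα1
  refine ⟨1 / π * C₂ * C₁, by positivity, fun n => ?_⟩
  set ν := volume.restrict (Set.Ioc (-π) π) with hν
  have hne : ∀ᵐ t ∂ν, t ≠ 0 := ae_restrict_of_ae (Measure.ae_ne volume 0)
  set k : ℝ → ℝ≥0∞ := fun t => ENNReal.ofReal (|fejerKernel n t| * |t| ^ α) with hk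
  set G : ℝ → ℝ → ℝ≥0∞ := fun x t => ‖f (x - t) - f x‖ₑ * (ENNReal.ofReal (|t| ^ α))⁻¹ with hG
  have hkm : Measurable k := by
    have := (continuous_fejerKernel n).measurable
    fun_prop
  have hGm : AEMeasurable (Function.uncurry G) (periodMeasure.prod ν) := by
    refine AEMeasurable.mul hf.aemeasurable_uncurry_sub (Measurable.aemeasurable ?_)
    fun_prop
  have hB : ∀ᵐ t ∂ν, ∫⁻ x, G x t ^ p ∂periodMeasure ≤ ENNReal.ofReal C₁ ^ p := by
    filter_upwards [hne] with t ht
    have ht0 : ENNReal.ofReal (|t| ^ α) ≠ 0 := by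
      have := abs_pos.2 ht
      simp only [ne_eq, ENNReal.ofReal_eq_zero, not_le]
      positivity
    have h := hC₁ (-t) (neg_ne_zero.2 ht)
    rw [eLpNorm_ofReal_eq_lintegral hp0, abs_neg, one_div, ENNReal.rpow_inv_le_iff hp0,
      ENNReal.ofReal_mul hC₁0, ENNReal.mul_rpow_of_nonneg _ _ hp0.le] at h
    simp only [hG, ENNReal.mul_rpow_of_nonneg _ _ hp0.le]
    rw [lintegral_mul_const' _ _ (by simp [ht0]), ENNReal.inv_rpow, ← div_eq_mul_inv]
    exact ENNReal.div_le_of_le_mul h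
  have hpt : ∀ x, ‖fejerMean f n x - f x‖ₑ ≤ ENNReal.ofReal (1 / π) * ∫⁻ t, k t * G x t ∂ν := by
    intro x
    rw [hf.fejerMean_sub_eq, enorm_mul, Real.enorm_of_nonneg (by positivity)]
    gcongr
    refine (enorm_integral_le_lintegral_enorm _).trans (lintegral_mono_ae ?_)
    filter_upwards [hne] with t ht
    have ht0 : ENNReal.ofReal (|t| ^ α) ≠ 0 := by
      have := abs_pos.2 ht
      simp only [ne_eq, ENNReal.ofReal_eq_zero, not_le]
      positivity
    rw [enorm_mul, hk, hG]
    simp only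
    rw [ENNReal.ofReal_mul (abs_nonneg _), ← Real.enorm_eq_ofReal_abs, mul_assoc,
      mul_left_comm (ENNReal.ofReal _), ENNReal.mul_inv_cancel ht0 ENNReal.ofReal_ne_top, mul_one]
  have hM := lintegral_lintegral_mul_rpow_le_of_forall_slice hp hkm.aemeasurable hGm hB
  rw [eLpNorm_ofReal_eq_lintegral hp0, one_div, ENNReal.rpow_inv_le_iff hp0]
  calc ∫⁻ x, ‖fejerMean f n x - f x‖ₑ ^ p ∂periodMeasure
      ≤ ∫⁻ x, (ENNReal.ofReal (1 / π)) ^ p * (∫⁻ t, k t * G x t ∂ν) ^ p ∂periodMeasure := by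
        refine lintegral_mono fun x => ?_
        rw [← ENNReal.mul_rpow_of_nonneg _ _ hp0.le]
        exact ENNReal.rpow_le_rpow (hpt x) hp0.le
    _ = (ENNReal.ofReal (1 / π)) ^ p * ∫⁻ x, (∫⁻ t, k t * G x t ∂ν) ^ p ∂periodMeasure :=
        lintegral_const_mul' _ _ (by simp [hp0.le])
    _ ≤ (ENNReal.ofReal (1 / π)) ^ p * ((ENNReal.ofReal (C₂ * ((n : ℝ) + 1) ^ (-α))) ^ p *
          ENNReal.ofReal C₁ ^ p) := by
        gcongr
        refine hM.trans ?_
        gcongr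
        exact hC₂ n
    _ = _ := by
        rw [← ENNReal.mul_rpow_of_nonneg _ _ hp0.le, ← ENNReal.mul_rpow_of_nonneg _ _ hp0.le,
          ← ENNReal.ofReal_mul (by positivity), ← ENNReal.ofReal_mul (by positivity)]
        congr 2
        ring

end LipClass

theorem partialFourierSum_sub {f g : ℝ → ℝ} (hf : Integrable f periodMeasure)
    (hg : Integrable g periodMeasure) (n : ℕ) (x : ℝ) :
    partialFourierSum (fun t => f t - g t) n x =
      partialFourierSum f n x - partialFourierSum g n x := by
  simp only [partialFourierSum_eq, sub_mul]
  rw [integral_sub (integrable_mul_dirichletKernel hf n x) (integrable_mul_dirichletKernel hg n x),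
    mul_sub]

theorem partialFourierSum_fejerMean {f : ℝ → ℝ} (hf : Integrable f periodMeasure) (n : ℕ) (x : ℝ) :
    partialFourierSum (fejerMean f n) n x = fejerMean f n x := by
  have hS : ∀ k ∈ Finset.range (n + 1), partialFourierSum f k x =
      (1 / π) * ∫ t, partialFourierSum f k t * dirichletKernel n (x - t) ∂periodMeasure :=
    fun k hk => by
      rw [← partialFourierSum_eq,
        partialFourierSum_partialFourierSum hf (Nat.lt_succ_iff.1 (Finset.mem_range.1 hk))]
  rw [fejerMean, Finset.sum_congr rfl hS, ← Finset.mul_sum, ← integral_finsetSum _ fun k _ =>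
    integrable_mul_dirichletKernel (continuous_partialFourierSum hf k).integrable_periodMeasure n x,
    partialFourierSum_eq, mul_left_comm, ← integral_const_mul (1 / ((n : ℝ) + 1))]
  simp only [fejerMean, mul_assoc, Finset.sum_mul]

theorem LipClass.exists_eLpNorm_partialFourierSum_sub_le {α p : ℝ} {f : ℝ → ℝ} (hp : 1 < p)
    (hα0 : 0 < α) (hα1 : α < 1) (hf : LipClass α p f) :
    ∃ C : ℝ, 0 ≤ C ∧ ∀ n : ℕ,
      eLpNorm (fun x => partialFourierSum f n x - f x) (ENNReal.ofReal p) periodMeasure ≤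
        ENNReal.ofReal (C * ((n : ℝ) + 1) ^ (-α)) := by
  have hp1 : 1 ≤ ENNReal.ofReal p := by simpa using hp.le
  obtain ⟨C, hC0, hC⟩ := hf.exists_eLpNorm_fejerMean_sub_le hp hα0 hα1
  obtain ⟨A, hA⟩ := exists_eLpNorm_partialFourierSum_le hp
  refine ⟨(A + 1) * C, by positivity, fun n => ?_⟩
  have hσ := continuous_fejerMean hf.integrable n
  set g : ℝ → ℝ := fun x => fejerMean f n x - f x with hg
  have hgm : MemLp g (ENNReal.ofReal p) periodMeasure :=
    ⟨hσ.aestronglyMeasurable.sub (hf.memLp hp).1, (hC n).trans_lt ENNReal.ofReal_lt_top⟩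
  have heq : (fun x => partialFourierSum f n x - f x) = g - partialFourierSum g n := by
    funext x
    rw [Pi.sub_apply, hg, partialFourierSum_sub hσ.integrable_periodMeasure hf.integrable,
      partialFourierSum_fejerMean hf.integrable]
    ring
  have hgi := MemLp.integrable_periodMeasure hp hgm
  rw [heq]
  calc eLpNorm (g - partialFourierSum g n) (ENNReal.ofReal p) periodMeasure
      ≤ eLpNorm g (ENNReal.ofReal p) periodMeasure +
          eLpNorm (partialFourierSum g n) (ENNReal.ofReal p) periodMeasure :=
        eLpNorm_sub_le hgm.1 (continuous_partialFourierSum hgi n).aestronglyMeasurable hp1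
    _ ≤ eLpNorm g (ENNReal.ofReal p) periodMeasure +
          A * eLpNorm g (ENNReal.ofReal p) periodMeasure := by gcongr; exact hA g hgm n
    _ = (A + 1) * eLpNorm g (ENNReal.ofReal p) periodMeasure := by ring
    _ ≤ (A + 1) * ENNReal.ofReal (C * ((n : ℝ) + 1) ^ (-α)) := by gcongr; exact hC n
    _ = _ := by
        rw [mul_assoc, ENNReal.ofReal_mul (p := (A : ℝ) + 1) (by positivity), ENNReal.ofReal_add (by positivity)
          zero_le_one, ENNReal.ofReal_coe_nnreal, ENNReal.ofReal_one]

theorem sum_range_succ_rpow_neg_le {α : ℝ} (hα0 : 0 < α) (hα1 : α < 1) (n : ℕ) :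
    ∑ k ∈ Finset.range (n + 1), ((k : ℝ) + 1) ^ (-α) ≤ ((n : ℝ) + 1) ^ (1 - α) / (1 - α) := by
  have h1α : 0 < 1 - α := by linarith
  induction n with
  | zero =>
    simp only [zero_add, Finset.sum_range_one, Nat.cast_zero, Real.one_rpow]
    rw [le_div_iff₀ h1α]
    linarith
  | succ n ih =>
    rw [Finset.sum_range_succ]
    refine (add_le_add_left ih _).trans ?_
    set x : ℝ := ((n + 1 : ℕ) : ℝ) + 1 with hx
    have hx0 : 0 < x := by positivity
    have hn : (n : ℝ) + 1 = x * (1 + -(1 / x)) := by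
      rw [hx]; push_cast; field_simp; ring
    have hx1 : 1 / x ≤ 1 := by
      rw [div_le_one hx0, hx]
      have : (0 : ℝ) ≤ ((n + 1 : ℕ) : ℝ) := by positivity
      linarith
    have hb := rpow_one_add_le_one_add_mul_self (s := -(1 / x)) (by linarith) h1α.le
      (by linarith : 1 - α ≤ 1)
    rw [hn, Real.mul_rpow hx0.le (by linarith), ← le_sub_iff_add_le, div_le_iff₀ h1α]
    refine (mul_le_mul_of_nonneg_left hb (by positivity)).trans_eq ?_
    rw [sub_mul (x ^ (1 - α) / (1 - α)), div_mul_cancel₀ _ h1α.ne', Real.rpow_sub hx0, Real.rpow_one, Real.rpow_neg hx0.le]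
    field_simp
    ring

theorem sum_mul_eq_sum_partialSum_mul_sub (w b : ℕ → ℝ) (n : ℕ) :
    ∑ k ∈ Finset.range (n + 1), w k * b k =
      (∑ k ∈ Finset.range (n + 1), w k) * b n +
        ∑ k ∈ Finset.range n, (∑ j ∈ Finset.range (k + 1), w j) * (b k - b (k + 1)) := by
  induction n with
  | zero => simp
  | succ n ih =>
    rw [Finset.sum_range_succ, ih, Finset.sum_range_succ w (n + 1),
      Finset.sum_range_succ (fun k => (∑ j ∈ Finset.range (k + 1), w j) * (b k - b (k + 1)))]
    ring

theorem sum_mul_le_of_almost_increasing_means {w b : ℕ → ℝ} (hb : Antitone b) (hb0 : ∀ n, 0 ≤ b n)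
    {K : ℝ} (hK : ∀ m n : ℕ, m ≤ n →
      (1 / ((m : ℝ) + 1)) * ∑ k ∈ Finset.range (m + 1), w k ≤
        K * ((1 / ((n : ℝ) + 1)) * ∑ k ∈ Finset.range (n + 1), w k)) (n : ℕ)
    (hP : 0 ≤ K * ∑ k ∈ Finset.range (n + 1), w k) :
    ∑ k ∈ Finset.range (n + 1), w k * b k ≤
      (∑ k ∈ Finset.range (n + 1), w k) *
        (b n + K / ((n : ℝ) + 1) * ∑ k ∈ Finset.range (n + 1), b k) := by
  set P := ∑ k ∈ Finset.range (n + 1), w k with hPdef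
  have hn : (0 : ℝ) < n + 1 := by positivity
  have hpar : ∑ k ∈ Finset.range n, ((k : ℝ) + 1) * (b k - b (k + 1)) ≤
      ∑ k ∈ Finset.range (n + 1), b k := by
    have h := sum_mul_eq_sum_partialSum_mul_sub (fun _ => 1) b n
    simp only [one_mul, Finset.sum_const, Finset.card_range, nsmul_eq_mul, mul_one] at h
    push_cast at h
    rw [h]
    exact le_add_of_nonneg_left (mul_nonneg hn.le (hb0 n))
  rw [sum_mul_eq_sum_partialSum_mul_sub, mul_add]
  refine add_le_add_right ?_ _
  calc ∑ k ∈ Finset.range n, (∑ j ∈ Finset.range (k + 1), w j) * (b k - b (k + 1))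
      ≤ ∑ k ∈ Finset.range n, K * P / (n + 1) * (((k : ℝ) + 1) * (b k - b (k + 1))) := by
        refine Finset.sum_le_sum fun k hk => ?_
        rw [← mul_assoc]
        refine mul_le_mul_of_nonneg_right ?_ (sub_nonneg.2 (hb k.le_succ))
        have hk1 : (0 : ℝ) < k + 1 := by positivity
        have h := hK k n (Finset.mem_range.1 hk).le
        rw [← div_le_iff₀ hk1]
        refine le_trans (le_of_eq ?_) (h.trans_eq ?_)
        · rw [one_div, div_eq_inv_mul]
        · rw [one_div, ← hPdef]; ring
    _ ≤ K * P / (n + 1) * ∑ k ∈ Finset.range (n + 1), b k := by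
        rw [← Finset.mul_sum]
        exact mul_le_mul_of_nonneg_left hpar (by positivity)
    _ = _ := by ring

/-- Corollary 1 (i): if `f ∈ Lip(α,p)`, `p > 1`, `0 < α < 1`, the
weights `(p_k)` are positive and `(p_k) ∈ AMIMS`, then
`‖R_n(f) - f‖_{L^p} = O(n^{-α})`. -/
theorem riesz_approx_AMIMS (p α : ℝ) (hp : 1 < p) (hα0 : 0 < α) (hα1 : α < 1)
    (f : ℝ → ℝ) (hf : LipClass α p f)
    (w : ℕ → ℝ) (hw : ∀ k, 0 < w k)
    (hAMIMS : ∃ K : ℝ, ∀ m n : ℕ, m ≤ n →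
      (1 / ((m : ℝ) + 1)) * ∑ k ∈ Finset.range (m + 1), w k ≤
        K * ((1 / ((n : ℝ) + 1)) * ∑ k ∈ Finset.range (n + 1), w k)) :
    ∃ C : ℝ, ∀ n : ℕ, 1 ≤ n →
      lpNorm p (fun x => rieszMeans w f n x - f x) ≤ C * (n : ℝ) ^ (-α) := by
  have hp0 : 0 < p := by linarith
  have hp1 : 1 ≤ ENNReal.ofReal p := by simpa using hp.le
  have h1α : 0 < 1 - α := by linarith
  obtain ⟨K, hK⟩ := hAMIMS
  obtain ⟨C, hC0, hC⟩ := hf.exists_eLpNorm_partialFourierSum_sub_le hp hα0 hα1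
  have hP : ∀ n, 0 < ∑ k ∈ Finset.range (n + 1), w k := fun n =>
    Finset.sum_pos (fun k _ => hw k) ⟨0, by simp⟩
  have hK0 : 0 < K := by
    have h := hK 0 0 le_rfl
    simp only [zero_add, Finset.sum_range_one, Nat.cast_zero, div_one, one_mul] at h
    exact pos_of_mul_pos_left ((hw 0).trans_le h) (hw 0).le
  set b : ℕ → ℝ := fun k => ((k : ℝ) + 1) ^ (-α) with hb
  have hb0 : ∀ k, 0 ≤ b k := fun k => by positivity
  have hbanti : Antitone b := fun m n hmn =>
    Real.rpow_le_rpow_of_nonpos (by positivity) (by gcongr) (by linarith)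
  refine ⟨(1 / (2 * π)) ^ (1 / p) * (C * (1 + K / (1 - α))), fun n hn => ?_⟩
  have hn0 : (0 : ℝ) < n := by exact_mod_cast hn
  set P := ∑ k ∈ Finset.range (n + 1), w k with hPdef
  have hPn : 0 < P := hP n
  have hsum : ∑ k ∈ Finset.range (n + 1), w k * b k ≤ P * ((1 + K / (1 - α)) * b n) := by
    refine (sum_mul_le_of_almost_increasing_means hbanti hb0 hK n (by positivity)).trans ?_
    refine mul_le_mul_of_nonneg_left ?_ hPn.le
    refine (add_le_add_right (mul_le_mul_of_nonneg_left (sum_range_succ_rpow_neg_le hα0 hα1 n)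
      (by positivity)) _).trans_eq ?_
    have hn1 : (0 : ℝ) < (n : ℝ) + 1 := by positivity
    rw [hb]
    simp only
    rw [sub_eq_add_neg, Real.rpow_add hn1, Real.rpow_one]
    field_simp
  have hcont := fun k => continuous_partialFourierSum hf.integrable k
  have hfm := (hf.memLp hp).1
  have heq : (fun x => rieszMeans w f n x - f x) =
      ∑ k ∈ Finset.range (n + 1), (w k / P) • fun x => partialFourierSum f k x - f x := by
    funext x
    simp only [rieszMeans, Finset.sum_apply, Pi.smul_apply, smul_eq_mul, mul_sub,
      Finset.sum_sub_distrib, ← Finset.sum_mul, ← Finset.sum_div, ← hPdef]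
    rw [div_self hPn.ne', one_mul, Finset.mul_sum]
    congr 1
    exact Finset.sum_congr rfl fun k _ => by ring
  have hmeas : ∀ k ∈ Finset.range (n + 1), AEStronglyMeasurable
      ((w k / P) • fun x => partialFourierSum f k x - f x) periodMeasure := fun k _ =>
    ((hcont k).aestronglyMeasurable.sub hfm).const_smul _
  have hbound : eLpNorm (fun x => rieszMeans w f n x - f x) (ENNReal.ofReal p) periodMeasure ≤
      ENNReal.ofReal (C * (1 + K / (1 - α)) * b n) := by
    rw [heq]
    refine (eLpNorm_sum_le hmeas hp1).trans ?_
    calc ∑ k ∈ Finset.range (n + 1), eLpNorm ((w k / P) • fun x => partialFourierSum f k x - f x)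
          (ENNReal.ofReal p) periodMeasure
        ≤ ∑ k ∈ Finset.range (n + 1), ENNReal.ofReal (w k / P * (C * b k)) := by
          refine Finset.sum_le_sum fun k _ => ?_
          have hwk := hw k
          rw [eLpNorm_const_smul, Real.enorm_of_nonneg (by positivity),
            ENNReal.ofReal_mul (by positivity)]
          gcongr
          exact hC k
      _ = ENNReal.ofReal (∑ k ∈ Finset.range (n + 1), w k / P * (C * b k)) := by
          rw [ENNReal.ofReal_sum_of_nonneg]
          intro k _
          have hwk := hw k
          have hbk := hb0 k
          positivity
      _ ≤ _ := by
          refine ENNReal.ofReal_le_ofReal ?_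
          have : ∑ k ∈ Finset.range (n + 1), w k / P * (C * b k) =
              C / P * ∑ k ∈ Finset.range (n + 1), w k * b k := by
            rw [Finset.mul_sum]
            exact Finset.sum_congr rfl fun k _ => by ring
          rw [this]
          refine (mul_le_mul_of_nonneg_left hsum (by positivity)).trans_eq ?_
          field_simp
  have hm : AEStronglyMeasurable (fun x => rieszMeans w f n x - f x) periodMeasure := by
    rw [heq]
    exact Finset.aestronglyMeasurable_sum _ hmeas
  rw [lpNorm_eq_toReal_eLpNorm hp0 hm, mul_assoc]
  refine mul_le_mul_of_nonneg_left ?_ (by positivity)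
  refine (ENNReal.toReal_le_of_le_ofReal (by have := hb0 n; positivity) hbound).trans ?_
  refine mul_le_mul_of_nonneg_left ?_ (by positivity)
  exact Real.rpow_le_rpow_of_nonpos hn0 (by linarith) (by linarith)
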